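/- arXiv:2501.15419 — 3 statements merged into one kernel-verified Lean document; each statement's English description precedes it below -/
import Mathlib

section
/- Let ρ₁, ρ₂, ρ₃ be forcing functions, μ_k > 0 with μ_k → 0, and let x_k ∈ E, z_k ∈ ℝ^m satisfy for every k: ‖∇_x L(x_k,z_k)‖ ≤ ρ₁(μ_k), (Σ_{i=1}^m ((z_k)_i g_i(x_k) − μ_k)²)^{1/2} ≤ ρ₂(μ_k), λ_min[H(x_k,z_k)] ≥ −ρ₃(μ_k), g_i(x_k) > 0 and (z_k)_i > 0 for all i, and suppose x_k → x* ∈ E. Let A(x*) = {i : g_i(x*) = 0} and assume the LICQ at x*: the family (∇g_i(x*))_{i∈A(x*)} is linearly independent. Assume further that the Hessians are locally Lipschitz at x*: there exist c > 0 and r > 0 such that ‖Hess f(x) − Hess f(x*)‖_op ≤ c‖x − x*‖ and ‖Hess g_i(x) − Hess g_i(x*)‖_op ≤ c‖x − x*‖ for all i and all x with ‖x − x*‖ ≤ r. Then there exists z* ∈ ℝ^m with z*_i ≥ 0 for all i such that the KKT conditions hold at (x*, z*): ∇_x L(x*,z*) = 0, g_i(x*) ≥ 0 and z*_i g_i(x*)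 = 0 for all i; and x* is a weak second-order stationary point: ⟨Hess_x L(x*,z*)v, v⟩ ≥ 0 for every v ∈ E with ⟨∇g_i(x*), v⟩ = 0 for all i ∈ A(x*). -/
open Filter Topology
open scoped RealInnerProductSpace BigOperators

noncomputable section

variable {E : Type*} [NormedAddCommGroup E] [InnerProductSpace ℝ E] [FiniteDimensional ℝ E]

/-- A forcing function: continuous on `[0,∞)`, nonnegative there, vanishing exactly at `0`. -/
def IsForcing (ρ : ℝ → ℝ) : Prop :=
  ContinuousOn ρ (Set.Ici 0) ∧ (∀ t, 0 ≤ t → 0 ≤ ρ t) ∧ ∀ t, 0 ≤ t → (ρ t = 0 ↔ t = 0)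

/-- The Hessian of `h` at `x`, i.e. the derivative of the gradient field of `h` at `x`. -/
def Hess (h : E → ℝ) (x : E) : E →L[ℝ] E := fderiv ℝ (gradient h) x

/-- Gradient of the Lagrangian `L(x,z) = f(x) - ∑ i, z i * g i x` with respect to `x`. -/
def gradL {m : ℕ} (f : E → ℝ) (g : Fin m → E → ℝ) (x : E) (z : Fin m → ℝ) : E :=
  gradient f x - ∑ i, z i • gradient (g i) x

/-- Hessian of the Lagrangian with respect to `x`. -/
def hessL {m : ℕ} (f : E → ℝ) (g : Fin m → E → ℝ) (x : E) (z : Fin m → ℝ) : E →L[ℝ] E :=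
  Hess f x - ∑ i, z i • Hess (g i) x

/-- The condensed primal-dual operator `H(x,z)`,
`H(x,z) v = Hess_x L(x,z) v + ∑ i (z i / g i x) ⟪∇g i x, v⟫ ∇g i x`. -/
def Hxz {m : ℕ} (f : E → ℝ) (g : Fin m → E → ℝ) (x : E) (z : Fin m → ℝ) : E →L[ℝ] E :=
  hessL f g x z +
    ∑ i, (z i / g i x) • ((innerSL ℝ (gradient (g i) x)).smulRight (gradient (g i) x))

/-- Smallest Rayleigh-quotient value of `A` over the unit sphere. -/
def lamMin (A : E →L[ℝ] E) : ℝ := sInf ((fun v => ⟪A v, v⟫) '' {v : E | ‖v‖ = 1})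

/-- The log-barrier merit function `φ_μ`. -/
def barrierPhi {m : ℕ} (μ : ℝ) (f : E → ℝ) (g : Fin m → E → ℝ) (x : E) : ℝ :=
  f x - μ * ∑ i, Real.log (g i x)

/-- The barrier gradient `q_μ(x) = ∇f(x) - μ ∑ i ∇g i (x) / g i x`. -/
def qmu {m : ℕ} (μ : ℝ) (f : E → ℝ) (g : Fin m → E → ℝ) (x : E) : E :=
  gradient f x - μ • ∑ i, (g i x)⁻¹ • gradient (g i) x

/-- Trust-region model `m_{x,z,μ}(d)`. -/
def trModel {m : ℕ} (μ : ℝ) (f : E → ℝ) (g : Fin m → E → ℝ) (x : E) (z : Fin m → ℝ)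
    (d : E) : ℝ :=
  (1/2) * ⟪Hxz f g x z d, d⟫ + ⟪qmu μ f g x, d⟫

/-- Predicted reduction of the step `d`. -/
def predRed {m : ℕ} (μ : ℝ) (f : E → ℝ) (g : Fin m → E → ℝ) (x : E) (z : Fin m → ℝ)
    (d : E) : ℝ :=
  - trModel μ f g x z d

/-- Actual reduction of the step `d`. -/
def aredRed {m : ℕ} (μ : ℝ) (f : E → ℝ) (g : Fin m → E → ℝ) (x : E) (d : E) : ℝ :=
  barrierPhi μ f g x - barrierPhi μ f g (x + d)


/-- If a family converges to a linearly independent one, it eventually admits a convergent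
biorthogonal family. -/
lemma exists_tendsto_biorthogonal {F ι κ : Type*} [NormedAddCommGroup F] [InnerProductSpace ℝ F]
    [Fintype ι] [DecidableEq ι] {l : Filter κ} {a : κ → ι → F} {b : ι → F}
    (hb : LinearIndependent ℝ b) (ha : ∀ i, Tendsto (fun k => a k i) l (𝓝 (b i))) :
    ∃ (u : κ → ι → F) (w : ι → F), (∀ i, Tendsto (fun k => u k i) l (𝓝 (w i))) ∧
      ∀ᶠ k in l, ∀ i j, ⟪a k i, u k j⟫ = if i = j then 1 else 0 := by
  have hdet : (Matrix.gram ℝ b).det ≠ 0 :=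
    ((Matrix.posSemidef_gram ℝ b).posDef_iff_det_ne_zero).1
      (Matrix.posDef_gram_of_linearIndependent hb)
  have hgram : Tendsto (fun k => Matrix.gram ℝ (a k)) l (𝓝 (Matrix.gram ℝ b)) :=
    tendsto_pi_nhds.2 fun i => tendsto_pi_nhds.2 fun j => (ha i).inner (ha j)
  have hinv : Tendsto (fun k => (Matrix.gram ℝ (a k))⁻¹) l (𝓝 (Matrix.gram ℝ b)⁻¹) := by
    refine (continuousAt_matrix_inv _ ?_).tendsto.comp hgram
    rw [Ring.inverse_eq_inv']
    exact continuousAt_inv₀ hdet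
  refine ⟨fun k j => ∑ p, (Matrix.gram ℝ (a k))⁻¹ p j • a k p,
    fun j => ∑ p, (Matrix.gram ℝ b)⁻¹ p j • b p, fun j => ?_, ?_⟩
  · refine tendsto_finsetSum _ fun p _ => Tendsto.smul ?_ (ha p)
    exact tendsto_pi_nhds.1 (tendsto_pi_nhds.1 hinv p) j
  · have hev : ∀ᶠ k in l, (Matrix.gram ℝ (a k)).det ≠ 0 :=
      ((continuous_id.matrix_det.tendsto _).comp hgram).eventually_ne hdet
    filter_upwards [hev] with k hk i j
    have hmul := congrFun (congrFun (Matrix.mul_nonsing_inv _ (isUnit_iff_ne_zero.2 hk)) i) j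
    rw [Matrix.mul_apply, Matrix.one_apply] at hmul
    rw [inner_sum, ← hmul]
    exact Finset.sum_congr rfl fun p _ => by rw [inner_smul_right, Matrix.gram_apply, mul_comm]

/-- Coefficients of a convergent combination of vectors converging to an independent family
converge. -/
lemma exists_tendsto_coeff {F ι κ : Type*} [NormedAddCommGroup F] [InnerProductSpace ℝ F]
    [Fintype ι] {l : Filter κ} {a : κ → ι → F} {b : ι → F}
    (hb : LinearIndependent ℝ b) (ha : ∀ i, Tendsto (fun k => a k i) l (𝓝 (b i)))
    {c : κ → ι → ℝ} {y : F} (hc : Tendsto (fun k => ∑ i, c k i • a k i) l (𝓝 y)) :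
    ∃ d : ι → ℝ, ∀ i, Tendsto (fun k => c k i) l (𝓝 (d i)) := by
  classical
  obtain ⟨u, w, hu, hau⟩ := exists_tendsto_biorthogonal hb ha
  refine ⟨fun i => ⟪y, w i⟫, fun i => (hc.inner (hu i)).congr' ?_⟩
  filter_upwards [hau] with k hk
  simp [sum_inner, inner_smul_left, hk]

/-- A vector orthogonal to an independent family is a limit of vectors orthogonal to the
approximating families. -/
lemma exists_tendsto_orthogonal {F ι κ : Type*} [NormedAddCommGroup F] [InnerProductSpace ℝ F]
    [Fintype ι] {l : Filter κ} {a : κ → ι → F} {b : ι → F}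
    (hb : LinearIndependent ℝ b) (ha : ∀ i, Tendsto (fun k => a k i) l (𝓝 (b i)))
    {v : F} (hv : ∀ i, ⟪b i, v⟫ = 0) :
    ∃ u : κ → F, Tendsto u l (𝓝 v) ∧ ∀ᶠ k in l, ∀ i, ⟪a k i, u k⟫ = 0 := by
  classical
  obtain ⟨u, w, hu, hau⟩ := exists_tendsto_biorthogonal hb ha
  refine ⟨fun k => v - ∑ i, ⟪a k i, v⟫ • u k i, ?_, ?_⟩
  · have h := (tendsto_const_nhds (x := v)).sub (tendsto_finsetSum Finset.univ fun i _ =>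
      ((ha i).inner (𝕜 := ℝ) (tendsto_const_nhds (x := v))).smul (hu i))
    simpa [hv] using h
  · filter_upwards [hau] with k hk i
    simp [inner_sub_right, inner_sum, inner_smul_right, hk]

lemma IsForcing.tendsto_comp {ρ : ℝ → ℝ} (hρ : IsForcing ρ) {κ : Type*} {l : Filter κ}
    {μ : κ → ℝ} (hμ : ∀ k, 0 ≤ μ k) (hμ0 : Tendsto μ l (𝓝 0)) :
    Tendsto (fun k => ρ (μ k)) l (𝓝 0) := by
  have h := (hρ.1 0 Set.self_mem_Ici).tendsto
  rw [(hρ.2.2 0 le_rfl).2 rfl] at h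
  exact h.comp (tendsto_nhdsWithin_iff.2 ⟨hμ0, Eventually.of_forall hμ⟩)

lemma lamMin_mul_norm_sq_le {F : Type*} [NormedAddCommGroup F] [InnerProductSpace ℝ F]
    (A : F →L[ℝ] F) (v : F) : lamMin A * ‖v‖ ^ 2 ≤ ⟪A v, v⟫ := by
  rcases eq_or_ne v 0 with rfl | hv
  · simp
  have hv' : 0 < ‖v‖ := norm_pos_iff.2 hv
  have hbdd : BddBelow ((fun v => ⟪A v, v⟫) '' {v : F | ‖v‖ = 1}) := by
    refine ⟨-‖A‖, ?_⟩
    rintro _ ⟨u, hu, rfl⟩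
    have hu : ‖u‖ = 1 := hu
    have h1 := (abs_le.1 (abs_real_inner_le_norm (A u) u)).1
    have h2 := A.le_opNorm u
    simp only [hu, mul_one] at h1 h2
    linarith
  have h : lamMin A ≤ ⟪A (‖v‖⁻¹ • v), ‖v‖⁻¹ • v⟫ :=
    csInf_le hbdd ⟨_, by simp [norm_smul, hv'.ne'], rfl⟩
  rw [map_smul, inner_smul_left, inner_smul_right, conj_trivial] at h
  calc lamMin A * ‖v‖ ^ 2 ≤ (‖v‖⁻¹ * (‖v‖⁻¹ * ⟪A v, v⟫)) * ‖v‖ ^ 2 := by gcongr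
    _ = ⟪A v, v⟫ := by field_simp

lemma contDiff_gradient {h : E → ℝ} (hh : ContDiff ℝ 2 h) : ContDiff ℝ 1 (gradient h) :=
  (InnerProductSpace.toDual ℝ E).symm.contDiff.comp (hh.fderiv_right (by norm_num))

lemma continuous_Hess {h : E → ℝ} (hh : ContDiff ℝ 2 h) : Continuous (Hess h) :=
  (contDiff_gradient hh).continuous_fderiv one_ne_zero

lemma inner_Hxz_self {m : ℕ} (f : E → ℝ) (g : Fin m → E → ℝ) (x : E) (z : Fin m → ℝ) (v : E) :
    ⟪Hxz f g x z v, v⟫ =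
      ⟪hessL f g x z v, v⟫ + ∑ i, z i / g i x * ⟪gradient (g i) x, v⟫ ^ 2 := by
  simp [Hxz, inner_add_left, sum_inner, inner_smul_left, pow_two]

lemma tendsto_gradL {m : ℕ} {f : E → ℝ} {g : Fin m → E → ℝ} (hf : ContDiff ℝ 2 f)
    (hg : ∀ i, ContDiff ℝ 2 (g i)) {κ : Type*} {l : Filter κ} {x : κ → E} {xs : E}
    (hx : Tendsto x l (𝓝 xs)) {z : κ → Fin m → ℝ} {zs : Fin m → ℝ}
    (hz : ∀ i, Tendsto (fun k => z k i) l (𝓝 (zs i))) :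
    Tendsto (fun k => gradL f g (x k) (z k)) l (𝓝 (gradL f g xs zs)) :=
  (((contDiff_gradient hf).continuous.tendsto xs).comp hx).sub <| tendsto_finsetSum _ fun i _ =>
    (hz i).smul (((contDiff_gradient (hg i)).continuous.tendsto xs).comp hx)

lemma tendsto_hessL {m : ℕ} {f : E → ℝ} {g : Fin m → E → ℝ} (hf : ContDiff ℝ 2 f)
    (hg : ∀ i, ContDiff ℝ 2 (g i)) {κ : Type*} {l : Filter κ} {x : κ → E} {xs : E}
    (hx : Tendsto x l (𝓝 xs)) {z : κ → Fin m → ℝ} {zs : Fin m → ℝ}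
    (hz : ∀ i, Tendsto (fun k => z k i) l (𝓝 (zs i))) :
    Tendsto (fun k => hessL f g (x k) (z k)) l (𝓝 (hessL f g xs zs)) :=
  (((continuous_Hess hf).tendsto xs).comp hx).sub <| tendsto_finsetSum _ fun i _ =>
    (hz i).smul (((continuous_Hess (hg i)).tendsto xs).comp hx)

/-- Under LICQ and local Lipschitzness of the Hessians, the limit of the
outer iterates is a KKT point and a weak second-order stationary point. -/
theorem outer_limit_is_KKT_and_wSOSP
    {E : Type*} [NormedAddCommGroup E] [InnerProductSpace ℝ E] [FiniteDimensional ℝ E]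
    [Nontrivial E] {m : ℕ} (hm : 1 ≤ m)
    (f : E → ℝ) (g : Fin m → E → ℝ)
    (hf : ContDiff ℝ 2 f) (hg : ∀ i, ContDiff ℝ 2 (g i))
    (ρ₁ ρ₂ ρ₃ : ℝ → ℝ) (hρ₁ : IsForcing ρ₁) (hρ₂ : IsForcing ρ₂) (hρ₃ : IsForcing ρ₃)
    (μ : ℕ → ℝ) (hμpos : ∀ k, 0 < μ k) (hμ0 : Tendsto μ atTop (𝓝 0))
    (x : ℕ → E) (z : ℕ → Fin m → ℝ)
    (h1 : ∀ k, ‖gradL f g (x k) (z k)‖ ≤ ρ₁ (μ k))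
    (h2 : ∀ k, Real.sqrt (∑ i, (z k i * g i (x k) - μ k) ^ 2) ≤ ρ₂ (μ k))
    (h3 : ∀ k, -ρ₃ (μ k) ≤ lamMin (Hxz f g (x k) (z k)))
    (h4 : ∀ k i, 0 < g i (x k) ∧ 0 < z k i)
    (xs : E) (hx : Tendsto x atTop (𝓝 xs))
    -- LICQ at `xs`: the active gradients are linearly independent
    (hLICQ : LinearIndependent ℝ (fun i : {i : Fin m // g i xs = 0} => gradient (g i.1) xs))
    -- local Lipschitzness of the Hessians at `xs`
    (c r : ℝ) (hc : 0 < c) (hr : 0 < r)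
    (hLipf : ∀ y : E, ‖y - xs‖ ≤ r → ‖Hess f y - Hess f xs‖ ≤ c * ‖y - xs‖)
    (hLipg : ∀ i, ∀ y : E, ‖y - xs‖ ≤ r → ‖Hess (g i) y - Hess (g i) xs‖ ≤ c * ‖y - xs‖) :
    ∃ zs : Fin m → ℝ, (∀ i, 0 ≤ zs i) ∧
      gradL f g xs zs = 0 ∧ (∀ i, 0 ≤ g i xs) ∧ (∀ i, zs i * g i xs = 0) ∧
      ∀ v : E, (∀ i, g i xs = 0 → ⟪gradient (g i) xs, v⟫ = 0) →
        0 ≤ ⟪hessL f g xs zs v, v⟫ := by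
  classical
  have hgx : ∀ i, Tendsto (fun k => g i (x k)) atTop (𝓝 (g i xs)) := fun i =>
    ((hg i).continuous.tendsto xs).comp hx
  have hdg : ∀ i, Tendsto (fun k => gradient (g i) (x k)) atTop (𝓝 (gradient (g i) xs)) :=
    fun i => ((contDiff_gradient (hg i)).continuous.tendsto xs).comp hx
  have hdf : Tendsto (fun k => gradient f (x k)) atTop (𝓝 (gradient f xs)) :=
    ((contDiff_gradient hf).continuous.tendsto xs).comp hx
  have hμ : ∀ k, 0 ≤ μ k := fun k => (hμpos k).le
  have hgs : ∀ i, 0 ≤ g i xs := fun i =>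
    ge_of_tendsto' (hgx i) fun k => (h4 k i).1.le
  have hgradL : Tendsto (fun k => gradL f g (x k) (z k)) atTop (𝓝 0) :=
    squeeze_zero_norm h1 (hρ₁.tendsto_comp hμ hμ0)
  have hzg : ∀ i, Tendsto (fun k => z k i * g i (x k)) atTop (𝓝 0) := fun i => by
    have h : Tendsto (fun k => z k i * g i (x k) - μ k) atTop (𝓝 0) :=
      squeeze_zero_norm (fun k => (Real.abs_le_sqrt (Finset.single_le_sum
        (f := fun i => (z k i * g i (x k) - μ k) ^ 2) (fun j _ => sq_nonneg _)
        (Finset.mem_univ i))).trans (h2 k)) (hρ₂.tendsto_comp hμ hμ0)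
    simpa using h.add hμ0
  have hz_inactive : ∀ i, g i xs ≠ 0 → Tendsto (fun k => z k i) atTop (𝓝 0) := fun i hi => by
    have h := (hzg i).div (hgx i) hi
    rw [zero_div] at h
    exact h.congr fun k => mul_div_cancel_right₀ _ (h4 k i).1.ne'
  have hcomb : Tendsto (fun k => ∑ i : {i // g i xs = 0}, z k i • gradient (g i) (x k)) atTop
      (𝓝 (gradient f xs)) := by
    have hin : Tendsto (fun k => ∑ i : {i // ¬ g i xs = 0}, z k i • gradient (g i) (x k)) atTop
        (𝓝 0) := by
      have h := tendsto_finsetSum Finset.univ fun (i : {i // ¬ g i xs = 0}) _ =>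
        (hz_inactive i i.2).smul (hdg i)
      simpa using h
    have h := (hdf.sub hgradL).sub hin
    rw [sub_zero, sub_zero] at h
    refine h.congr fun k => ?_
    rw [gradL, sub_sub_cancel, ← Fintype.sum_subtype_add_sum_subtype (fun i => g i xs = 0),
      add_sub_cancel_right]
  obtain ⟨d, hd⟩ := exists_tendsto_coeff hLICQ (fun i => hdg i) (c := fun k i => z k i) hcomb
  obtain ⟨zs, hzs⟩ : ∃ zs : Fin m → ℝ, ∀ i, Tendsto (fun k => z k i) atTop (𝓝 (zs i)) := by
    refine ⟨fun i => if h : g i xs = 0 then d ⟨i, h⟩ else 0, fun i => ?_⟩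
    by_cases h : g i xs = 0
    · simpa [h] using hd ⟨i, h⟩
    · simpa [h] using hz_inactive i h
  have hcompl : ∀ i, zs i * g i xs = 0 := fun i =>
    tendsto_nhds_unique ((hzs i).mul (hgx i)) (hzg i)
  refine ⟨zs, fun i => ge_of_tendsto' (hzs i) fun k => (h4 k i).2.le,
    tendsto_nhds_unique (tendsto_gradL hf hg hx hzs) hgradL, hgs, hcompl, fun v hv => ?_⟩
  obtain ⟨u, hu, hau⟩ := exists_tendsto_orthogonal hLICQ (fun i => hdg i) (v := v)
    fun i => hv i i.2
  have hbarrier : Tendsto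
      (fun k => ∑ i, z k i / g i (x k) * ⟪gradient (g i) (x k), u k⟫ ^ 2) atTop (𝓝 0) := by
    rw [← Finset.sum_const_zero (s := (Finset.univ : Finset (Fin m)))]
    refine tendsto_finsetSum _ fun i _ => ?_
    by_cases hi : g i xs = 0
    · refine tendsto_const_nhds.congr' ?_
      filter_upwards [hau] with k hk
      simp [hk ⟨i, hi⟩]
    · simpa using ((hz_inactive i hi).div (hgx i) hi).mul (((hdg i).inner hu).pow 2)
  have hupper : Tendsto (fun k => ⟪Hxz f g (x k) (z k) (u k), u k⟫) atTop
      (𝓝 ⟪hessL f g xs zs v, v⟫) := by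
    simp only [inner_Hxz_self]
    have hHu : Tendsto (fun k => hessL f g (x k) (z k) (u k)) atTop (𝓝 (hessL f g xs zs v)) :=
      (isBoundedBilinearMap_apply.continuous.tendsto (hessL f g xs zs, v)).comp
        ((tendsto_hessL hf hg hx hzs).prodMk_nhds hu)
    simpa using (hHu.inner hu).add hbarrier
  have hlower : Tendsto (fun k => -ρ₃ (μ k) * ‖u k‖ ^ 2) atTop (𝓝 0) := by
    simpa using (hρ₃.tendsto_comp hμ hμ0).neg.mul (hu.norm.pow 2)
  exact le_of_tendsto_of_tendsto' hlower hupper fun k =>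
    (mul_le_mul_of_nonneg_right (h3 k) (sq_nonneg _)).trans (lamMin_mul_norm_sq_le _ _)

end
end

section
/- Under the inner-iteration setting, lim_{ℓ→∞} ‖q_μ(x^ℓ)‖ = 0. -/
open Filter Topology
open scoped RealInnerProductSpace BigOperators

noncomputable section

variable {E : Type*} [NormedAddCommGroup E] [InnerProductSpace ℝ E] [FiniteDimensional ℝ E]

/-- The inner-iteration setting of the interior-point trust-region method (with the
log-barrier merit function), including all standing assumptions. -/
structure InnerSetting (m : ℕ) (f : E → ℝ) (g : Fin m → E → ℝ)
    (μ τ κC ω Δmax : ℝ)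
    (x : ℕ → E) (z : ℕ → Fin m → ℝ) (d : ℕ → E) (Δ : ℕ → ℝ) : Prop where
  hm : 1 ≤ m
  hf : ContDiff ℝ 2 f
  hg : ∀ i, ContDiff ℝ 2 (g i)
  hμ : 0 < μ
  hτ : 0 < τ ∧ τ < 1/4
  hκC : 0 < κC
  hω : 0 < ω ∧ ω < 1
  hΔmax : 0 < Δmax
  hΔ : ∀ ℓ, 0 < Δ ℓ ∧ Δ ℓ ≤ Δmax
  /-- (i) strict feasibility of the iterates -/
  hgpos : ∀ ℓ i, 0 < g i (x ℓ)
  hzpos : ∀ ℓ i, 0 < z ℓ i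
  /-- (ii) the step is inside the trust region -/
  hdΔ : ∀ ℓ, ‖d ℓ‖ ≤ Δ ℓ
  /-- (iii) Cauchy decrease, case `H^ℓ = 0` -/
  cauchy_zero : ∀ ℓ, Hxz f g (x ℓ) (z ℓ) = 0 →
    κC * ‖qmu μ f g (x ℓ)‖ * Δ ℓ ≤ predRed μ f g (x ℓ) (z ℓ) (d ℓ)
  /-- (iii) Cauchy decrease, case `H^ℓ ≠ 0` -/
  cauchy : ∀ ℓ, Hxz f g (x ℓ) (z ℓ) ≠ 0 →
    κC * ‖qmu μ f g (x ℓ)‖ *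
        min (Δ ℓ) (‖qmu μ f g (x ℓ)‖ / ‖Hxz f g (x ℓ) (z ℓ)‖) ≤
      predRed μ f g (x ℓ) (z ℓ) (d ℓ)
  /-- (iv) update on a successful iteration -/
  succ_update : ∀ ℓ, ((∀ i, 0 < g i (x ℓ + d ℓ)) ∧
      τ * predRed μ f g (x ℓ) (z ℓ) (d ℓ) < aredRed μ f g (x ℓ) (d ℓ)) →
    x (ℓ + 1) = x ℓ + d ℓ
  /-- (iv) update on an unsuccessful iteration -/
  fail_update : ∀ ℓ, ¬((∀ i, 0 < g i (x ℓ + d ℓ)) ∧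
      τ * predRed μ f g (x ℓ) (z ℓ) (d ℓ) < aredRed μ f g (x ℓ) (d ℓ)) →
    x (ℓ + 1) = x ℓ ∧ z (ℓ + 1) = z ℓ
  /-- (v) radius update: infeasible trial point -/
  Δ_infeas : ∀ ℓ, (∃ i, g i (x ℓ + d ℓ) ≤ 0) → Δ (ℓ + 1) = ω * ‖d ℓ‖
  /-- (v) radius update: shrink -/
  Δ_shrink : ∀ ℓ, (∀ i, 0 < g i (x ℓ + d ℓ)) →
    aredRed μ f g (x ℓ) (d ℓ) < predRed μ f g (x ℓ) (z ℓ) (d ℓ) / 4 →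
    Δ (ℓ + 1) = Δ ℓ / 4
  /-- (v) radius update: expand -/
  Δ_expand : ∀ ℓ, (∀ i, 0 < g i (x ℓ + d ℓ)) →
    (3/4) * predRed μ f g (x ℓ) (z ℓ) (d ℓ) ≤ aredRed μ f g (x ℓ) (d ℓ) →
    ‖d ℓ‖ = Δ ℓ → Δ (ℓ + 1) = min (2 * Δ ℓ) Δmax
  /-- (v) radius update: remaining cases -/
  Δ_keep : ∀ ℓ, (∀ i, 0 < g i (x ℓ + d ℓ)) →
    ¬(aredRed μ f g (x ℓ) (d ℓ) < predRed μ f g (x ℓ) (z ℓ) (d ℓ) / 4) →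
    ¬((3/4) * predRed μ f g (x ℓ) (z ℓ) (d ℓ) ≤ aredRed μ f g (x ℓ) (d ℓ) ∧ ‖d ℓ‖ = Δ ℓ) →
    Δ (ℓ + 1) = Δ ℓ
  /-- uniform bounds along the iterates -/
  bound_fbelow : ∃ Lb : ℝ, ∀ ℓ, Lb ≤ f (x ℓ)
  bound_g : ∃ U > (0:ℝ), ∀ ℓ i, g i (x ℓ) ≤ U
  bound_gradg : ∃ Cg > (0:ℝ), ∀ ℓ i, ‖gradient (g i) (x ℓ)‖ ≤ Cg
  bound_hessg : ∃ CG > (0:ℝ), ∀ ℓ i, ‖Hess (g i) (x ℓ)‖ ≤ CG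
  bound_hessf : ∃ Cf > (0:ℝ), ∀ ℓ, ‖Hess f (x ℓ)‖ ≤ Cf
  bound_z : ∃ Cz > (0:ℝ), ∀ ℓ i, z ℓ i ≤ Cz
  /-- uniform continuity of each `g i` along the iterates -/
  unif_cont : ∀ η > (0:ℝ), ∃ δ > (0:ℝ), ∀ ℓ i (v : E), ‖v‖ ≤ δ →
    |g i (x ℓ + v) - g i (x ℓ)| ≤ η
  /-- radial Lipschitz bound for the gradients of the constraints -/
  radial_grad : ∃ β₁ > (0:ℝ), ∃ δ₁ > (0:ℝ), ∀ ℓ i (t : ℝ) (v : E), 0 ≤ t → t * ‖v‖ ≤ δ₁ →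
    |⟪gradient (g i) (x ℓ + t • v) - gradient (g i) (x ℓ), v⟫| ≤ β₁ * t * ‖v‖ ^ 2
  /-- radial Lipschitz bound for the Hessians of `f` and of the constraints -/
  radial_hess : ∃ β₂ > (0:ℝ), ∃ δ₂ > (0:ℝ), ∀ ℓ (t : ℝ) (v : E), 0 ≤ t → t * ‖v‖ ≤ δ₂ →
    |⟪(Hess f (x ℓ + t • v) - Hess f (x ℓ)) v, v⟫| ≤ β₂ * t * ‖v‖ ^ 3 ∧
    ∀ i, |⟪(Hess (g i) (x ℓ + t • v) - Hess (g i) (x ℓ)) v, v⟫| ≤ β₂ * t * ‖v‖ ^ 3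

/-- First-order Taylor estimate from a bound on the radial variation of the gradient. -/
lemma abs_taylor_sub_le_of_radial_gradient {h : E → ℝ} (hh : Differentiable ℝ h) (y v : E) {B : ℝ}
    (hB : ∀ t ∈ Set.Icc (0 : ℝ) 1, |⟪gradient h (y + t • v) - gradient h y, v⟫| ≤ B) :
    |h (y + v) - h y - ⟪gradient h y, v⟫| ≤ B := by
  have hline : ∀ t : ℝ, HasDerivAt (fun s : ℝ => y + s • v) v t := fun t => by
    simpa using ((hasDerivAt_id t).smul_const v).const_add y
  have hd : ∀ t : ℝ, HasDerivAt (fun s : ℝ => h (y + s • v) - s * ⟪gradient h y, v⟫)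
      (⟪gradient h (y + t • v) - gradient h y, v⟫) t := fun t => by
    have h1 := ((hh (y + t • v)).hasGradientAt.hasFDerivAt).comp_hasDerivAt t (hline t)
    have h2 := h1.sub ((hasDerivAt_id t).mul_const ⟪gradient h y, v⟫)
    refine h2.congr_deriv ?_
    simp [inner_sub_left]
  have := norm_image_sub_le_of_norm_deriv_le_segment_01' (C := B)
    (fun t _ => (hd t).hasDerivWithinAt)
    (fun t ht => by simpa using hB t ⟨ht.1, ht.2.le⟩)
  rw [Real.norm_eq_abs] at this
  convert this using 2
  simp
  ring

/-- First-order Taylor estimate from a bound on the quadratic form of the Hessian along a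
segment. -/
lemma abs_taylor_sub_le_of_radial_hess {h : E → ℝ} (hh : ContDiff ℝ 2 h) (y v : E) {B : ℝ}
    (hB : ∀ t ∈ Set.Icc (0 : ℝ) 1, |⟪Hess h (y + t • v) v, v⟫| ≤ B) :
    |h (y + v) - h y - ⟪gradient h y, v⟫| ≤ B := by
  have hgrad : Differentiable ℝ (gradient h) := by
    have h1 : ContDiff ℝ 1 (fderiv ℝ h) := hh.fderiv_right (by norm_num)
    exact ((InnerProductSpace.toDual ℝ E).symm.contDiff.comp h1).differentiable (by norm_num)
  have hB0 : 0 ≤ B := (abs_nonneg _).trans (hB 0 (by simp))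
  refine abs_taylor_sub_le_of_radial_gradient (hh.differentiable (by norm_num)) y v fun t ht => ?_
  have hline : ∀ s : ℝ, HasDerivAt (fun r : ℝ => y + r • v) v s := fun s => by
    simpa using ((hasDerivAt_id s).smul_const v).const_add y
  have hd : ∀ s : ℝ, HasDerivAt (fun r : ℝ => ⟪gradient h (y + r • v), v⟫)
      (⟪Hess h (y + s • v) v, v⟫) s := fun s => by
    have h1 := (hgrad (y + s • v)).hasFDerivAt.comp_hasDerivAt s (hline s)
    have h2 := h1.inner ℝ (hasDerivAt_const s v)
    refine h2.congr_deriv ?_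
    simp [Hess]
  have := (convex_Icc (0 : ℝ) 1).norm_image_sub_le_of_norm_hasDerivWithin_le (C := B)
    (fun s _ => (hd s).hasDerivWithinAt) (fun s hs => by simpa using hB s hs)
    (by simp : (0 : ℝ) ∈ Set.Icc (0 : ℝ) 1) ht
  rw [Real.norm_eq_abs, Real.norm_eq_abs, sub_zero, abs_of_nonneg ht.1] at this
  simp only [zero_smul, add_zero, ← inner_sub_left] at this
  exact this.trans (mul_le_of_le_one_right hB0 ht.2)

/-- Second-order estimate for the logarithm away from zero. -/
lemma abs_log_sub_log_sub_div_le {a b ε : ℝ} (hε : 0 < ε) (ha : ε ≤ a) (hb : ε / 2 ≤ b) :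
    |Real.log b - Real.log a - (b - a) / a| ≤ 2 / ε ^ 2 * (b - a) ^ 2 := by
  have ha0 : 0 < a := hε.trans_le ha
  have hb0 : 0 < b := (half_pos hε).trans_le hb
  have h1 := Real.log_le_sub_one_of_pos (div_pos hb0 ha0)
  have h2 := Real.one_sub_inv_le_log_of_pos (div_pos hb0 ha0)
  rw [Real.log_div hb0.ne' ha0.ne'] at h1 h2
  have hdiv : b / a - 1 = (b - a) / a := by field_simp
  have hab : ε ^ 2 / 2 ≤ a * b := by nlinarith
  have hq : (b - a) / a - (1 - (b / a)⁻¹) = (b - a) ^ 2 / (a * b) := by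
    field_simp
  have hle : (b - a) ^ 2 / (a * b) ≤ 2 / ε ^ 2 * (b - a) ^ 2 := by
    calc (b - a) ^ 2 / (a * b) ≤ (b - a) ^ 2 / (ε ^ 2 / 2) := by gcongr
      _ = _ := by field_simp
  rw [hdiv] at h1
  rw [abs_le]
  have hnonneg : 0 ≤ (b - a) ^ 2 / (a * b) := by positivity
  constructor <;> linarith

/-- Two points at which a function has first-order expansions with a common quadratic error have
close gradients. -/
lemma norm_sub_le_of_taylor {F : Type*} [NormedAddCommGroup F] [InnerProductSpace ℝ F]
    {φ : F → ℝ} {y y' q q' : F} {C δ : ℝ}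
    (h : ∀ v : F, ‖v‖ ≤ δ → |φ (y + v) - φ y - ⟪q, v⟫| ≤ C * ‖v‖ ^ 2)
    (h' : ∀ v : F, ‖v‖ ≤ δ → |φ (y' + v) - φ y' - ⟪q', v⟫| ≤ C * ‖v‖ ^ 2)
    (hC : 0 ≤ C) (hne : y ≠ y') (hclose : ‖y' - y‖ ≤ δ / 2) :
    ‖q' - q‖ ≤ 6 * C * ‖y' - y‖ := by
  set r := ‖y' - y‖ with hr
  have hr0 : 0 < r := norm_pos_iff.2 (sub_ne_zero.2 hne.symm)
  rcases eq_or_ne (q' - q) 0 with h0 | h0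
  · rw [h0, norm_zero]; positivity
  have hn : 0 < ‖q' - q‖ := norm_pos_iff.2 h0
  set w : F := (r / ‖q' - q‖) • (q' - q) with hw
  have hwn : ‖w‖ = r := by
    rw [hw, norm_smul, Real.norm_of_nonneg (by positivity)]
    field_simp
  have hin : ⟪q' - q, w⟫ = r * ‖q' - q‖ := by
    rw [hw, real_inner_smul_right, real_inner_self_eq_norm_sq]
    field_simp
  have hsum : ‖y' - y + w‖ ≤ 2 * r := (norm_add_le _ _).trans (by rw [hwn, ← hr]; linarith)
  have h1 := h (y' - y) (by rw [← hr]; linarith)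
  have h2 := h (y' - y + w) (by linarith)
  have h3 := h' w (by linarith)
  rw [add_sub_cancel] at h1
  rw [← add_assoc, add_sub_cancel, inner_add_right] at h2
  rw [inner_sub_left] at hin
  rw [← hr] at h1
  rw [hwn] at h3
  have h4 : C * ‖y' - y + w‖ ^ 2 ≤ C * (2 * r) ^ 2 := by gcongr
  have h5 : r * ‖q' - q‖ ≤ r * (6 * C * r) := by
    nlinarith [abs_le.1 h1, abs_le.1 h2, abs_le.1 h3]
  exact le_of_mul_le_mul_left h5 hr0

namespace InnerSetting

variable {m : ℕ} {f : E → ℝ} {g : Fin m → E → ℝ} {μ τ κC ω Δmax : ℝ}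
  {x : ℕ → E} {z : ℕ → Fin m → ℝ} {d : ℕ → E} {Δ : ℕ → ℝ}

lemma cauchy_of_norm_le (hset : InnerSetting m f g μ τ κC ω Δmax x z d Δ) {M : ℝ}
    {ℓ : ℕ} (hM : ‖Hxz f g (x ℓ) (z ℓ)‖ ≤ M) :
    κC * ‖qmu μ f g (x ℓ)‖ * min (Δ ℓ) (‖qmu μ f g (x ℓ)‖ / M) ≤
      predRed μ f g (x ℓ) (z ℓ) (d ℓ) := by
  have hκ := hset.hκC
  by_cases h : Hxz f g (x ℓ) (z ℓ) = 0
  · refine le_trans ?_ (hset.cauchy_zero ℓ h)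
    gcongr
    exact min_le_left _ _
  · have := norm_pos_iff.2 h
    refine le_trans ?_ (hset.cauchy ℓ h)
    gcongr

lemma predRed_nonneg (hset : InnerSetting m f g μ τ κC ω Δmax x z d Δ) (ℓ : ℕ) :
    0 ≤ predRed μ f g (x ℓ) (z ℓ) (d ℓ) := by
  have hκ := hset.hκC
  have hΔ := (hset.hΔ ℓ).1.le
  refine le_trans ?_ (hset.cauchy_of_norm_le le_rfl)
  have : 0 ≤ min (Δ ℓ) (‖qmu μ f g (x ℓ)‖ / ‖Hxz f g (x ℓ) (z ℓ)‖) :=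
    le_min hΔ (by positivity)
  positivity

lemma barrierPhi_antitone (hset : InnerSetting m f g μ τ κC ω Δmax x z d Δ) :
    Antitone fun ℓ => barrierPhi μ f g (x ℓ) := by
  refine antitone_nat_of_succ_le fun ℓ => ?_
  by_cases h : (∀ i, 0 < g i (x ℓ + d ℓ)) ∧
      τ * predRed μ f g (x ℓ) (z ℓ) (d ℓ) < aredRed μ f g (x ℓ) (d ℓ)
  · have h1 := mul_nonneg hset.hτ.1.le (hset.predRed_nonneg ℓ)
    have h2 := h.2
    rw [hset.succ_update ℓ h]
    unfold aredRed at h2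
    linarith
  · rw [(hset.fail_update ℓ h).1]

lemma barrierPhi_bddBelow (hset : InnerSetting m f g μ τ κC ω Δmax x z d Δ) :
    BddBelow (Set.range fun ℓ => barrierPhi μ f g (x ℓ)) := by
  obtain ⟨Lb, hLb⟩ := hset.bound_fbelow
  obtain ⟨U, hU0, hU⟩ := hset.bound_g
  refine ⟨Lb - μ * ∑ _i : Fin m, Real.log U, ?_⟩
  rintro _ ⟨ℓ, rfl⟩
  refine sub_le_sub (hLb ℓ) (mul_le_mul_of_nonneg_left ?_ hset.hμ.le)
  exact Finset.sum_le_sum fun i _ => Real.log_le_log (hset.hgpos ℓ i) (hU ℓ i)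

lemma exists_barrierPhi_limit (hset : InnerSetting m f g μ τ κC ω Δmax x z d Δ) :
    ∃ L, (∀ ℓ, L ≤ barrierPhi μ f g (x ℓ)) ∧
      Tendsto (fun ℓ => barrierPhi μ f g (x ℓ)) atTop (𝓝 L) :=
  ⟨_, ciInf_le hset.barrierPhi_bddBelow,
    tendsto_atTop_ciInf hset.barrierPhi_antitone hset.barrierPhi_bddBelow⟩

/-- The constraint values stay bounded away from zero along the iterates. -/
lemma exists_slack_lower_bound (hset : InnerSetting m f g μ τ κC ω Δmax x z d Δ) :
    ∃ ε > (0 : ℝ), ∀ ℓ i, ε ≤ g i (x ℓ) := by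
  obtain ⟨Lb, hLb⟩ := hset.bound_fbelow
  obtain ⟨U, hU0, hU⟩ := hset.bound_g
  refine ⟨Real.exp ((Lb - barrierPhi μ f g (x 0)) / μ - ((m : ℝ) - 1) * Real.log U),
    Real.exp_pos _, fun ℓ i => ?_⟩
  rw [← Real.le_log_iff_exp_le (hset.hgpos ℓ i)]
  have h1 : barrierPhi μ f g (x ℓ) ≤ barrierPhi μ f g (x 0) :=
    hset.barrierPhi_antitone (Nat.zero_le ℓ)
  have h2 : (Lb - barrierPhi μ f g (x 0)) / μ ≤ ∑ j, Real.log (g j (x ℓ)) := by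
    rw [div_le_iff₀ hset.hμ]
    have h3 : barrierPhi μ f g (x ℓ) = f (x ℓ) - μ * ∑ j, Real.log (g j (x ℓ)) := rfl
    linarith [hLb ℓ]
  have h3 : ∑ j ∈ Finset.univ.erase i, Real.log (g j (x ℓ)) ≤ ((m : ℝ) - 1) * Real.log U := by
    calc _ ≤ ∑ _j ∈ Finset.univ.erase i, Real.log U :=
          Finset.sum_le_sum fun j _ => Real.log_le_log (hset.hgpos ℓ j) (hU ℓ j)
      _ = _ := by
          rw [Finset.sum_const, Finset.card_erase_of_mem (Finset.mem_univ i), Finset.card_univ,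
            Fintype.card_fin, nsmul_eq_mul, Nat.cast_sub hset.hm, Nat.cast_one]
  have h4 := Finset.add_sum_erase Finset.univ (fun j => Real.log (g j (x ℓ))) (Finset.mem_univ i)
  linarith

lemma exists_norm_Hxz_le (hset : InnerSetting m f g μ τ κC ω Δmax x z d Δ) :
    ∃ M > (0 : ℝ), ∀ ℓ, ‖Hxz f g (x ℓ) (z ℓ)‖ ≤ M := by
  obtain ⟨ε, hε, hgε⟩ := hset.exists_slack_lower_bound
  obtain ⟨Cg, hCg, hCg'⟩ := hset.bound_gradg
  obtain ⟨CG, hCG, hCG'⟩ := hset.bound_hessg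
  obtain ⟨Cf, hCf, hCf'⟩ := hset.bound_hessf
  obtain ⟨Cz, hCz, hCz'⟩ := hset.bound_z
  refine ⟨Cf + ∑ _i : Fin m, Cz * CG + ∑ _i : Fin m, Cz / ε * (Cg * Cg), by positivity,
    fun ℓ => ?_⟩
  unfold Hxz hessL
  refine (norm_add_le _ _).trans (add_le_add ((norm_sub_le _ _).trans
    (add_le_add (hCf' ℓ) (norm_sum_le_of_le _ fun i _ => ?_)))
    (norm_sum_le_of_le _ fun i _ => ?_))
  · rw [norm_smul, Real.norm_of_nonneg (hset.hzpos ℓ i).le]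
    exact mul_le_mul (hCz' ℓ i) (hCG' ℓ i) (norm_nonneg _) hCz.le
  · have hz := (hset.hzpos ℓ i).le
    have hg := (hset.hgpos ℓ i)
    rw [norm_smul, Real.norm_of_nonneg (by positivity), ContinuousLinearMap.norm_smulRight_apply,
      innerSL_apply_norm]
    gcongr
    exacts [hCz' ℓ i, hgε ℓ i, hCg' ℓ i, hCg' ℓ i]

/-- Uniform feasibility and uniform first-order expansion of the merit function around the
iterates. -/
lemma exists_barrierPhi_taylor (hset : InnerSetting m f g μ τ κC ω Δmax x z d Δ) :
    ∃ C > (0 : ℝ), ∃ δ > (0 : ℝ), ∀ ℓ (v : E), ‖v‖ ≤ δ → (∀ i, 0 < g i (x ℓ + v)) ∧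
      |barrierPhi μ f g (x ℓ + v) - barrierPhi μ f g (x ℓ) - ⟪qmu μ f g (x ℓ), v⟫| ≤
        C * ‖v‖ ^ 2 := by
  obtain ⟨ε, hε, hgε⟩ := hset.exists_slack_lower_bound
  obtain ⟨Cg, hCg, hCg'⟩ := hset.bound_gradg
  obtain ⟨Cf, hCf, hCf'⟩ := hset.bound_hessf
  obtain ⟨δ₀, hδ₀, hcont⟩ := hset.unif_cont (ε / 2) (half_pos hε)
  obtain ⟨β₁, hβ₁, δ₁, hδ₁, hgrad⟩ := hset.radial_grad
  obtain ⟨β₂, hβ₂, δ₂, hδ₂, hhess⟩ := hset.radial_hess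
  have hμ := hset.hμ
  set K : ℝ := 2 / ε ^ 2 * (β₁ + Cg) ^ 2 + β₁ / ε with hK
  refine ⟨Cf + β₂ + μ * ∑ _i : Fin m, K, by positivity, min (min δ₀ δ₁) (min δ₂ 1),
    by positivity, fun ℓ v hv => ?_⟩
  simp only [le_min_iff] at hv
  obtain ⟨⟨hv0, hv1⟩, hv2, hv3⟩ := hv
  have hscale : ∀ t ∈ Set.Icc (0 : ℝ) 1, ∀ δ' : ℝ, ‖v‖ ≤ δ' → t * ‖v‖ ≤ δ' :=
    fun t ht δ' h => (mul_le_of_le_one_left (norm_nonneg v) ht.2).trans h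
  have hhalf : ∀ i, ε / 2 ≤ g i (x ℓ + v) := fun i => by
    linarith [(abs_le.1 (hcont ℓ i v hv0)).1, hgε ℓ i]
  refine ⟨fun i => (half_pos hε).trans_le (hhalf i), ?_⟩
  have hfT : |f (x ℓ + v) - f (x ℓ) - ⟪gradient f (x ℓ), v⟫| ≤ (Cf + β₂) * ‖v‖ ^ 2 := by
    refine abs_taylor_sub_le_of_radial_hess hset.hf _ _ fun t ht => ?_
    have h1 := (hhess ℓ t v ht.1 (hscale t ht _ hv2)).1
    have h2 : |⟪Hess f (x ℓ) v, v⟫| ≤ Cf * ‖v‖ ^ 2 := by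
      refine (abs_real_inner_le_norm _ _).trans ?_
      have := (Hess f (x ℓ)).le_of_opNorm_le (hCf' ℓ) v
      nlinarith [norm_nonneg v]
    have h3 : β₂ * t * ‖v‖ ^ 3 ≤ β₂ * ‖v‖ ^ 2 := by
      have : t * ‖v‖ ≤ 1 := hscale t ht 1 hv3
      nlinarith [mul_nonneg hβ₂.le (sq_nonneg ‖v‖)]
    have h4 : ⟪Hess f (x ℓ + t • v) v, v⟫ =
        ⟪(Hess f (x ℓ + t • v) - Hess f (x ℓ)) v, v⟫ + ⟪Hess f (x ℓ) v, v⟫ := by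
      rw [sub_apply, inner_sub_left]; ring
    rw [h4]
    exact (abs_add_le _ _).trans (by linarith)
  have hlogT : ∀ i, |Real.log (g i (x ℓ + v)) - Real.log (g i (x ℓ)) -
      (g i (x ℓ))⁻¹ * ⟪gradient (g i) (x ℓ), v⟫| ≤ K * ‖v‖ ^ 2 := fun i => by
    have hgi := hset.hgpos ℓ i
    have h1 : |g i (x ℓ + v) - g i (x ℓ) - ⟪gradient (g i) (x ℓ), v⟫| ≤ β₁ * ‖v‖ ^ 2 := by
      refine abs_taylor_sub_le_of_radial_gradient ((hset.hg i).differentiable (by norm_num)) _ _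
        fun t ht => (hgrad ℓ i t v ht.1 (hscale t ht _ hv1)).trans ?_
      gcongr
      exact mul_le_of_le_one_right hβ₁.le ht.2
    have h2 : |⟪gradient (g i) (x ℓ), v⟫| ≤ Cg * ‖v‖ :=
      (abs_real_inner_le_norm _ _).trans (by gcongr; exact hCg' ℓ i)
    have h3 : |g i (x ℓ + v) - g i (x ℓ)| ≤ (β₁ + Cg) * ‖v‖ := by
      have h4 := abs_add_le (g i (x ℓ + v) - g i (x ℓ) - ⟪gradient (g i) (x ℓ), v⟫)
        ⟪gradient (g i) (x ℓ), v⟫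
      rw [sub_add_cancel] at h4
      nlinarith [norm_nonneg v, mul_nonneg hβ₁.le (norm_nonneg v)]
    have h4 := abs_log_sub_log_sub_div_le hε (hgε ℓ i) (hhalf i)
    have h5 : (g i (x ℓ + v) - g i (x ℓ)) ^ 2 ≤ (β₁ + Cg) ^ 2 * ‖v‖ ^ 2 := by
      rw [← sq_abs, ← mul_pow]
      gcongr
    have h6 : |(g i (x ℓ + v) - g i (x ℓ) - ⟪gradient (g i) (x ℓ), v⟫) / g i (x ℓ)| ≤
        β₁ * ‖v‖ ^ 2 / ε := by
      rw [abs_div, abs_of_pos hgi]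
      gcongr
      exact hgε ℓ i
    have h7 : 2 / ε ^ 2 * (g i (x ℓ + v) - g i (x ℓ)) ^ 2 ≤
        2 / ε ^ 2 * ((β₁ + Cg) ^ 2 * ‖v‖ ^ 2) := by gcongr
    calc _ = |(Real.log (g i (x ℓ + v)) - Real.log (g i (x ℓ)) -
            (g i (x ℓ + v) - g i (x ℓ)) / g i (x ℓ)) +
            (g i (x ℓ + v) - g i (x ℓ) - ⟪gradient (g i) (x ℓ), v⟫) / g i (x ℓ)| := by
          congr 1
          field_simp
          ring
      _ ≤ 2 / ε ^ 2 * ((β₁ + Cg) ^ 2 * ‖v‖ ^ 2) + β₁ * ‖v‖ ^ 2 / ε :=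
          (abs_add_le _ _).trans (add_le_add (h4.trans h7) h6)
      _ = _ := by rw [hK]; ring
  have hsplit : barrierPhi μ f g (x ℓ + v) - barrierPhi μ f g (x ℓ) - ⟪qmu μ f g (x ℓ), v⟫ =
      (f (x ℓ + v) - f (x ℓ) - ⟪gradient f (x ℓ), v⟫) -
      μ * ∑ i, (Real.log (g i (x ℓ + v)) - Real.log (g i (x ℓ)) -
        (g i (x ℓ))⁻¹ * ⟪gradient (g i) (x ℓ), v⟫) := by
    simp only [barrierPhi, qmu, inner_sub_left, real_inner_smul_left, sum_inner,
      Finset.sum_sub_distrib]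
    ring
  rw [hsplit]
  refine (abs_sub _ _).trans ?_
  rw [abs_mul, abs_of_pos hμ, add_mul (Cf + β₂), mul_assoc μ, Finset.sum_mul]
  exact add_le_add hfT (mul_le_mul_of_nonneg_left
    ((Finset.abs_sum_le_sum_abs _ _).trans (Finset.sum_le_sum fun i _ => hlogT i)) hμ.le)

/-- While the barrier gradient is bounded away from zero, so are the radii. -/
lemma exists_radius_lower_bound (hset : InnerSetting m f g μ τ κC ω Δmax x z d Δ)
    {ε : ℝ} (hε : 0 < ε) {K : ℕ} (hK : ∀ ℓ, K ≤ ℓ → ε ≤ ‖qmu μ f g (x ℓ)‖) :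
    ∃ D > (0 : ℝ), ∀ ℓ, K ≤ ℓ → D ≤ Δ ℓ := by
  obtain ⟨M, hM, hHM⟩ := hset.exists_norm_Hxz_le
  obtain ⟨C, hC, δ, hδ, hT⟩ := hset.exists_barrierPhi_taylor
  have hκ := hset.hκC
  obtain ⟨hω0, hω1⟩ := hset.hω
  set δ' := min δ (min (ε / M) (κC * ε / (4 * (C + M)))) with hδ'
  have hδ'0 : 0 < δ' := by positivity
  have hgood : ∀ ℓ, K ≤ ℓ → Δ ℓ ≤ δ' → 0 < predRed μ f g (x ℓ) (z ℓ) (d ℓ) ∧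
      (3/4) * predRed μ f g (x ℓ) (z ℓ) (d ℓ) ≤ aredRed μ f g (x ℓ) (d ℓ) := by
    intro ℓ hℓ hΔℓ
    have hΔ0 := (hset.hΔ ℓ).1
    simp only [hδ', le_min_iff] at hΔℓ
    obtain ⟨hΔ1, hΔ2, hΔ3⟩ := hΔℓ
    have hq := hK ℓ hℓ
    have hpred : κC * ε * Δ ℓ ≤ predRed μ f g (x ℓ) (z ℓ) (d ℓ) := by
      refine le_trans ?_ (hset.cauchy_of_norm_le (hHM ℓ))
      gcongr
      exact le_min le_rfl (hΔ2.trans (by gcongr))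
    have hT' := (hT ℓ (d ℓ) ((hset.hdΔ ℓ).trans hΔ1)).2
    have hH : |⟪Hxz f g (x ℓ) (z ℓ) (d ℓ), d ℓ⟫| ≤ M * ‖d ℓ‖ ^ 2 := by
      refine (abs_real_inner_le_norm _ _).trans ?_
      have := (Hxz f g (x ℓ) (z ℓ)).le_of_opNorm_le (hHM ℓ) (d ℓ)
      nlinarith [norm_nonneg (d ℓ)]
    have hd2 : (C + M) * ‖d ℓ‖ ^ 2 ≤ (C + M) * Δ ℓ ^ 2 := by
      gcongr
      exact hset.hdΔ ℓ
    have hquad : (C + M) * Δ ℓ ^ 2 ≤ κC * ε * Δ ℓ / 4 := by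
      rw [le_div_iff₀ (by positivity)] at hΔ3
      nlinarith
    have hMd : 0 ≤ M * ‖d ℓ‖ ^ 2 := by positivity
    have hpos : 0 < κC * ε * Δ ℓ := by positivity
    refine ⟨hpos.trans_le hpred, ?_⟩
    have e1 : predRed μ f g (x ℓ) (z ℓ) (d ℓ) =
        -((1/2) * ⟪Hxz f g (x ℓ) (z ℓ) (d ℓ), d ℓ⟫ + ⟪qmu μ f g (x ℓ), d ℓ⟫) := rfl
    have e2 : aredRed μ f g (x ℓ) (d ℓ) =
        barrierPhi μ f g (x ℓ) - barrierPhi μ f g (x ℓ + d ℓ) := rfl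
    linarith [(abs_le.1 hT').2, (abs_le.1 hH).1]
  have hstep : ∀ ℓ, K ≤ ℓ → min (Δ ℓ) (min ω (1/4) * δ') ≤ Δ (ℓ + 1) := by
    intro ℓ hℓ
    have hΔ0 := (hset.hΔ ℓ).1
    by_cases hfeas : ∀ i, 0 < g i (x ℓ + d ℓ)
    · by_cases hs : aredRed μ f g (x ℓ) (d ℓ) < predRed μ f g (x ℓ) (z ℓ) (d ℓ) / 4
      · rw [hset.Δ_shrink ℓ hfeas hs]
        have hlt : δ' < Δ ℓ := by
          by_contra! hcon
          have := hgood ℓ hℓ hcon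
          linarith
        refine (min_le_right _ _).trans ?_
        nlinarith [min_le_right ω (1/4)]
      · refine (min_le_left _ _).trans ?_
        by_cases he : (3/4) * predRed μ f g (x ℓ) (z ℓ) (d ℓ) ≤ aredRed μ f g (x ℓ) (d ℓ) ∧
            ‖d ℓ‖ = Δ ℓ
        · rw [hset.Δ_expand ℓ hfeas he.1 he.2]
          exact le_min (by linarith) (hset.hΔ ℓ).2
        · rw [hset.Δ_keep ℓ hfeas hs he]
    · have hlt : δ' < ‖d ℓ‖ := by
        by_contra! hcon
        exact hfeas (hT ℓ (d ℓ) (hcon.trans (min_le_left _ _))).1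
      push Not at hfeas
      rw [hset.Δ_infeas ℓ hfeas]
      refine (min_le_right _ _).trans ?_
      gcongr
      exact min_le_left _ _
  refine ⟨min (Δ K) (min ω (1/4) * δ'), lt_min (hset.hΔ K).1 (by positivity), fun ℓ hℓ => ?_⟩
  induction ℓ, hℓ using Nat.le_induction with
  | base => exact min_le_left _ _
  | succ n hn ih => exact (le_min ih (min_le_right _ _)).trans (hstep n hn)

/-- The barrier gradient gets arbitrarily small infinitely often. -/
lemma exists_norm_qmu_lt (hset : InnerSetting m f g μ τ κC ω Δmax x z d Δ)
    {ε : ℝ} (hε : 0 < ε) (K : ℕ) : ∃ ℓ, K ≤ ℓ ∧ ‖qmu μ f g (x ℓ)‖ < ε := by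
  by_contra! hK
  obtain ⟨D, hD, hΔD⟩ := hset.exists_radius_lower_bound hε hK
  obtain ⟨M, hM, hHM⟩ := hset.exists_norm_Hxz_le
  obtain ⟨L, hL, hlim⟩ := hset.exists_barrierPhi_limit
  have hκ := hset.hκC
  obtain ⟨hτ0, hτ1⟩ := hset.hτ
  obtain ⟨hω0, hω1⟩ := hset.hω
  set p := κC * ε * min D (ε / M) with hp
  have hp0 : 0 < p := by positivity
  have hpred : ∀ ℓ, K ≤ ℓ → p ≤ predRed μ f g (x ℓ) (z ℓ) (d ℓ) := fun ℓ hℓ => by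
    have hq := hK ℓ hℓ
    have hD' := hΔD ℓ hℓ
    refine le_trans ?_ (hset.cauchy_of_norm_le (hHM ℓ))
    rw [hp]
    gcongr
  obtain ⟨N, hN⟩ := eventually_atTop.1
    (hlim.eventually_lt_const (show L < L + τ * p by linarith [mul_pos hτ0 hp0]))
  set θ := max ω (1/4) with hθ
  have hθ0 : 0 ≤ θ := hω0.le.trans (le_max_left _ _)
  have hθ1 : θ < 1 := max_lt hω1 (by norm_num)
  have hcontr : ∀ ℓ, max K N ≤ ℓ → Δ (ℓ + 1) ≤ θ * Δ ℓ := by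
    intro ℓ hℓ
    have hΔ0 := (hset.hΔ ℓ).1
    have hpℓ := hpred ℓ (le_of_max_le_left hℓ)
    have hfail : ¬((∀ i, 0 < g i (x ℓ + d ℓ)) ∧
        τ * predRed μ f g (x ℓ) (z ℓ) (d ℓ) < aredRed μ f g (x ℓ) (d ℓ)) := fun h => by
      have h1 := h.2
      have h2 := hL (ℓ + 1)
      rw [hset.succ_update ℓ h] at h2
      have h3 := hN ℓ (le_of_max_le_right hℓ)
      have h4 := mul_le_mul_of_nonneg_left hpℓ hτ0.le
      unfold aredRed at h1
      linarith
    by_cases hfeas : ∀ i, 0 < g i (x ℓ + d ℓ)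
    · have h1 : aredRed μ f g (x ℓ) (d ℓ) ≤ τ * predRed μ f g (x ℓ) (z ℓ) (d ℓ) := by
        by_contra! h
        exact hfail ⟨hfeas, h⟩
      rw [hset.Δ_shrink ℓ hfeas (by nlinarith)]
      nlinarith [le_max_right ω (1/4)]
    · push Not at hfeas
      rw [hset.Δ_infeas ℓ hfeas]
      exact mul_le_mul (le_max_left _ _) (hset.hdΔ ℓ) (norm_nonneg _) hθ0
  have hgeom : ∀ n, Δ (max K N + n) ≤ θ ^ n * Δ (max K N) := fun n => by
    induction n with
    | zero => simp
    | succ n ih =>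
      calc Δ (max K N + (n + 1)) ≤ θ * Δ (max K N + n) := hcontr _ (Nat.le_add_right _ _)
        _ ≤ θ * (θ ^ n * Δ (max K N)) := by gcongr
        _ = _ := by ring
  have hzero : Tendsto (fun n : ℕ => θ ^ n * Δ (max K N)) atTop (𝓝 0) := by
    simpa using (tendsto_pow_atTop_nhds_zero_of_lt_one hθ0 hθ1).mul_const (Δ (max K N))
  obtain ⟨n, hn⟩ := (hzero.eventually_lt_const hD).exists
  linarith [hgeom n, hΔD (max K N + n) ((le_max_left _ _).trans (Nat.le_add_right _ _))]

/-- Lipschitz-type estimate for the barrier gradient between nearby iterates. -/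
lemma exists_norm_qmu_sub_le (hset : InnerSetting m f g μ τ κC ω Δmax x z d Δ) :
    ∃ C > (0 : ℝ), ∃ δ > (0 : ℝ), ∀ k ℓ, ‖x k - x ℓ‖ ≤ δ →
      ‖qmu μ f g (x k) - qmu μ f g (x ℓ)‖ ≤ C * ‖x k - x ℓ‖ := by
  obtain ⟨C, hC, δ, hδ, hT⟩ := hset.exists_barrierPhi_taylor
  refine ⟨6 * C, by positivity, δ / 2, half_pos hδ, fun k ℓ hkℓ => ?_⟩
  rcases eq_or_ne (x ℓ) (x k) with h | h
  · simp [h]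
  · exact norm_sub_le_of_taylor (fun v hv => (hT ℓ v hv).2) (fun v hv => (hT k v hv).2) hC.le h hkℓ

/-- Merit decrease in terms of the distance between consecutive iterates. -/
lemma barrierPhi_decrease (hset : InnerSetting m f g μ τ κC ω Δmax x z d Δ) {M : ℝ} (hM : 0 < M)
    (hHM : ∀ ℓ, ‖Hxz f g (x ℓ) (z ℓ)‖ ≤ M) {ε : ℝ} (hε : 0 < ε) {ℓ : ℕ}
    (hq : ε ≤ ‖qmu μ f g (x ℓ)‖) :
    τ * (κC * ε * min ‖x (ℓ + 1) - x ℓ‖ (ε / M)) ≤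
      barrierPhi μ f g (x ℓ) - barrierPhi μ f g (x (ℓ + 1)) := by
  have hκ := hset.hκC
  have hτ := hset.hτ.1
  have hdΔ := hset.hdΔ ℓ
  by_cases h : (∀ i, 0 < g i (x ℓ + d ℓ)) ∧
      τ * predRed μ f g (x ℓ) (z ℓ) (d ℓ) < aredRed μ f g (x ℓ) (d ℓ)
  · rw [hset.succ_update ℓ h, add_sub_cancel_left]
    refine le_trans ?_ h.2.le
    refine mul_le_mul_of_nonneg_left (le_trans ?_ (hset.cauchy_of_norm_le (hHM ℓ))) hτ.le
    gcongr
  · rw [(hset.fail_update ℓ h).1]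
    simp [(div_pos hε hM).le]

end InnerSetting

/-- Under the inner-iteration setting,
`lim_{ℓ→∞} ‖q_μ(x^ℓ)‖ = 0`. -/
theorem inner_lim_qmu_eq_zero
    {E : Type*} [NormedAddCommGroup E] [InnerProductSpace ℝ E] [FiniteDimensional ℝ E]
    [Nontrivial E] {m : ℕ}
    (f : E → ℝ) (g : Fin m → E → ℝ) (μ τ κC ω Δmax : ℝ)
    (x : ℕ → E) (z : ℕ → Fin m → ℝ) (d : ℕ → E) (Δ : ℕ → ℝ)
    (hset : InnerSetting m f g μ τ κC ω Δmax x z d Δ) :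
    Tendsto (fun ℓ => ‖qmu μ f g (x ℓ)‖) atTop (𝓝 0) := by
  obtain ⟨M, hM, hHM⟩ := hset.exists_norm_Hxz_le
  obtain ⟨C, hC, δ, hδ, hLip⟩ := hset.exists_norm_qmu_sub_le
  obtain ⟨L, hL, hlim⟩ := hset.exists_barrierPhi_limit
  have hκ := hset.hκC
  have hτ := hset.hτ.1
  refine Metric.tendsto_atTop.2 fun ε₂ hε₂ => ?_
  set ε := ε₂ / 2 with hε
  have hε0 : 0 < ε := half_pos hε₂
  set c := τ * (κC * ε) with hc
  have hc0 : 0 < c := by positivity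
  set η := min (ε / M) (min δ (ε / C)) with hη
  have hη0 : 0 < η := by positivity
  obtain ⟨N, hN⟩ := eventually_atTop.1
    (hlim.eventually_lt_const (show L < L + c * η by linarith [mul_pos hc0 hη0]))
  refine ⟨N, fun ℓ hℓ => ?_⟩
  rw [Real.dist_eq, sub_zero, abs_norm]
  by_contra! hbig
  have hfar : ∀ j, ℓ ≤ j → c * ‖x j - x ℓ‖ ≤ barrierPhi μ f g (x ℓ) - barrierPhi μ f g (x j) →
      ε ≤ ‖qmu μ f g (x j)‖ := fun j _ h => by
    have h1 : ‖x j - x ℓ‖ ≤ η := by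
      refine le_of_mul_le_mul_left ?_ hc0
      linarith [hN ℓ hℓ, hL j]
    simp only [hη, le_min_iff] at h1
    have h2 := hLip j ℓ h1.2.1
    have h3 := h1.2.2
    rw [le_div_iff₀ hC] at h3
    have h4 := norm_sub_norm_le (qmu μ f g (x ℓ)) (qmu μ f g (x j))
    rw [norm_sub_rev] at h4
    linarith
  have htravel : ∀ j, ℓ ≤ j →
      c * ‖x j - x ℓ‖ ≤ barrierPhi μ f g (x ℓ) - barrierPhi μ f g (x j) := fun j hj => by
    induction j, hj using Nat.le_induction with
    | base => simp
    | succ n hn ih =>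
      have h1 := hset.barrierPhi_decrease hM hHM hε0 (hfar n hn ih)
      have h2 : c * min ‖x (n + 1) - x n‖ (ε / M) < c * (ε / M) := by
        have h3 : c * η ≤ c * (ε / M) := by gcongr; exact min_le_left _ _
        rw [hc] at h3 ⊢
        linarith [hN n (hℓ.trans hn), hL (n + 1)]
      have h4 : min ‖x (n + 1) - x n‖ (ε / M) = ‖x (n + 1) - x n‖ := by
        rcases min_choice ‖x (n + 1) - x n‖ (ε / M) with h | h
        · exact h
        · rw [h] at h2
          exact absurd h2 (lt_irrefl _)
      rw [h4] at h1
      have h5 : c * ‖x (n + 1) - x ℓ‖ ≤ c * (‖x (n + 1) - x n‖ + ‖x n - x ℓ‖) := by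
        gcongr
        exact norm_sub_le_norm_sub_add_norm_sub _ _ _
      rw [hc] at h5 ih ⊢
      linarith
  obtain ⟨j, hj, hsmall⟩ := hset.exists_norm_qmu_lt hε0 ℓ
  exact absurd (hfar j hj (htravel j hj)) (not_le.2 hsmall)

end
end

section
/- Under the inner-iteration setting, if in addition lim_{ℓ→∞} max_{1≤i≤m} |z^ℓ_i − μ/g_i(x^ℓ)| = 0, then lim_{ℓ→∞} ‖∇_x L(x^ℓ, z^ℓ)‖ = 0. -/
open Filter Topology
open scoped RealInnerProductSpace BigOperators

noncomputable section

variable {E : Type*} [NormedAddCommGroup E] [InnerProductSpace ℝ E] [FiniteDimensional ℝ E]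

/-- Abstract trust-region convergence: `q` plays the role of the gradient, `Φ` of the merit function
values, `Δ` of the radii, and `S` singles out the successful iterations. -/
lemma tendsto_norm_zero_of_trustRegion {E : Type*} [NormedAddCommGroup E] 
    {x q : ℕ → E} {Δ Φ : ℕ → ℝ} {S : ℕ → Prop}
    {κ C ρ B : ℝ} (hκ : 0 < κ) (hC : 0 < C) (hρ : 0 ≤ ρ) (hρ1 : ρ < 1)
    (hΔ : ∀ l, 0 < Δ l) (hB : ∀ l, B ≤ Φ l)
    (hdec : ∀ l, S l → κ * ‖q l‖ * min (Δ l) (‖q l‖ / C) ≤ Φ l - Φ (l + 1))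
    (hstep : ∀ l, S l → ‖x (l + 1) - x l‖ ≤ Δ l)
    (hfail : ∀ l, ¬ S l → x (l + 1) = x l ∧ Φ (l + 1) = Φ l)
    (hkeep : ∀ ε > 0, ∃ a > 0, ∀ l, ε ≤ ‖q l‖ → min (Δ l) a ≤ Δ (l + 1))
    (hshrink : ∀ l, ¬ S l → q l ≠ 0 → Δ (l + 1) ≤ ρ * Δ l)
    (hq : ∀ ε > 0, ∃ δ > 0, ∀ k l, ‖x k - x l‖ ≤ δ → ‖q k - q l‖ < ε) :
    Tendsto (fun l => ‖q l‖) atTop (𝓝 0) := by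
  have hdec' : ∀ e > 0, ∀ l, S l → e ≤ ‖q l‖ →
      κ * e * min (Δ l) (e / C) ≤ Φ l - Φ (l + 1) := by
    intro e he l hS hel
    refine le_trans ?_ (hdec l hS)
    have := hΔ l
    gcongr
  have hanti : Antitone Φ := by
    refine antitone_nat_of_succ_le fun l => ?_
    by_cases hS : S l
    · have h1 := hdec l hS
      have h2 : 0 ≤ κ * ‖q l‖ * min (Δ l) (‖q l‖ / C) :=
        mul_nonneg (by positivity) (le_min (hΔ l).le (by positivity))
      linarith
    · exact (hfail l hS).2.le
  have hcauchy : ∀ η > 0, ∃ N, ∀ j ≥ N, ∀ k, Φ j - Φ k < η := by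
    intro η hη
    have hbdd : BddBelow (Set.range Φ) := ⟨B, by rintro _ ⟨l, rfl⟩; exact hB l⟩
    have hlim := tendsto_atTop_ciInf hanti hbdd
    obtain ⟨N, hN⟩ := (hlim.eventually_lt_const (lt_add_of_pos_right _ hη)).exists_forall_of_atTop
    refine ⟨N, fun j hj k => ?_⟩
    have := hN j hj
    have := ciInf_le hbdd k
    linarith
  have hfreq : ∀ e > 0, ∀ N, ∃ k ≥ N, ‖q k‖ < e := by
    intro e he N
    by_contra! hcon
    obtain ⟨a, ha, hka⟩ := hkeep e he
    have hlow : ∀ k, N ≤ k → min (Δ N) a ≤ Δ k := by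
      intro k hk
      induction k, hk using Nat.le_induction with
      | base => exact min_le_left _ _
      | succ k hk ih => exact (le_min ih (min_le_right _ _)).trans (hka k (hcon k hk))
    have ha' : 0 < min (Δ N) a := lt_min (hΔ N) ha
    have hc : 0 < κ * e * min (min (Δ N) a) (e / C) :=
      mul_pos (mul_pos hκ he) (lt_min ha' (div_pos he hC))
    obtain ⟨N', hN'⟩ := hcauchy _ hc
    have hnS : ∀ k, max N N' ≤ k → ¬ S k := by
      intro k hk hS
      have h1 := hdec' e he k hS (hcon k ((le_max_left _ _).trans hk))
      have h2 := hN' k ((le_max_right _ _).trans hk) (k + 1)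
      have h3 : κ * e * min (min (Δ N) a) (e / C) ≤ κ * e * min (Δ k) (e / C) := by
        have := hlow k ((le_max_left _ _).trans hk)
        gcongr
      linarith
    have hgeo : ∀ n, Δ (max N N' + n) ≤ ρ ^ n * Δ (max N N') := by
      intro n
      induction n with
      | zero => simp
      | succ n ih =>
        have hle : N ≤ max N N' + n := (le_max_left _ _).trans (Nat.le_add_right _ _)
        have hq0 : q (max N N' + n) ≠ 0 := norm_pos_iff.1 (he.trans_le (hcon _ hle))
        calc Δ (max N N' + n + 1) ≤ ρ * Δ (max N N' + n) :=
              hshrink _ (hnS _ (Nat.le_add_right _ _)) hq0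
          _ ≤ ρ * (ρ ^ n * Δ (max N N')) := by gcongr
          _ = ρ ^ (n + 1) * Δ (max N N') := by ring
    obtain ⟨n, hn⟩ := exists_pow_lt_of_lt_one (div_pos ha' (hΔ (max N N'))) hρ1
    rw [lt_div_iff₀ (hΔ _)] at hn
    have := hgeo n
    have := hlow (max N N' + n) ((le_max_left _ _).trans (Nat.le_add_right _ _))
    linarith
  rw [Metric.tendsto_atTop]
  intro ε hε
  obtain ⟨e, he, rfl⟩ : ∃ e > 0, ε = 2 * e := ⟨ε / 2, by positivity, by ring⟩
  obtain ⟨δ, hδ, hqδ⟩ := hq e he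
  have hc : 0 < κ * e := by positivity
  obtain ⟨N, hN⟩ := hcauchy (κ * e * min (e / C) δ) (mul_pos hc (lt_min (by positivity) hδ))
  refine ⟨N, fun l hl => ?_⟩
  rw [dist_zero_right, norm_norm]
  classical
  have hex := hfreq e he l
  obtain ⟨hlk, hqk⟩ := Nat.find_spec hex
  have hmin : ∀ j, l ≤ j → j < Nat.find hex → e ≤ ‖q j‖ := by
    intro j hj hjk
    by_contra! hlt
    exact Nat.find_min hex hjk ⟨hj, hlt⟩
  have htrav : ∀ j, l ≤ j → j ≤ Nat.find hex → κ * e * ‖x j - x l‖ ≤ Φ l - Φ j := by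
    intro j hj
    induction j, hj using Nat.le_induction with
    | base => simp
    | succ j hj ih =>
      intro hjk
      have ih' := ih (Nat.le_of_succ_le hjk)
      by_cases hS : S j
      · have h1 := hdec' e he j hS (hmin j hj hjk)
        have h2 := hN j (hl.trans hj) (j + 1)
        have h3 : min (Δ j) (e / C) < min (e / C) δ := lt_of_mul_lt_mul_left (h1.trans_lt h2) hc.le
        have h4 : min (Δ j) (e / C) = Δ j := by
          refine min_eq_left (le_of_not_gt fun h => ?_)
          rw [min_eq_right h.le] at h3
          exact absurd (h3.trans_le (min_le_left _ _)) (lt_irrefl _)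
        rw [h4] at h1
        have h5 : ‖x (j + 1) - x l‖ ≤ Δ j + ‖x j - x l‖ :=
          (norm_sub_le_norm_sub_add_norm_sub _ (x j) _).trans (by gcongr; exact hstep j hS)
        have h6 := mul_le_mul_of_nonneg_left h5 hc.le
        linarith
      · obtain ⟨hx, hΦ⟩ := hfail j hS
        rwa [hx, hΦ]
  have hdist : ‖x (Nat.find hex) - x l‖ ≤ δ := by
    have h1 := (htrav _ hlk le_rfl).trans_lt (hN l hl _)
    exact (lt_of_mul_lt_mul_left h1 hc.le).le.trans (min_le_right _ _)
  have h1 := hqδ _ _ hdist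
  have h2 := norm_sub_norm_le (q l) (q (Nat.find hex))
  rw [norm_sub_rev] at h2
  linarith

/-- Second-order remainder estimate along a segment, from a bound on the quadratic form of the
Hessian. -/
lemma abs_sub_sub_inner_gradient_le {h : E → ℝ} (hh : ContDiff ℝ 2 h) {x v : E} {K : ℝ}
    (hK : ∀ t ∈ Set.Icc (0 : ℝ) 1, |⟪Hess h (x + t • v) v, v⟫| ≤ K) :
    |h (x + v) - h x - ⟪gradient h x, v⟫| ≤ K := by
  have hline : ∀ t : ℝ, HasDerivAt (fun t : ℝ => x + t • v) v t := fun t => by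
    simpa using ((hasDerivAt_id t).smul_const v).const_add x
  have hgrad : Differentiable ℝ (gradient h) :=
    (InnerProductSpace.toDual ℝ E).symm.toContinuousLinearEquiv.differentiable.comp
      ((hh.fderiv_right (m := 1) (by norm_num)).differentiable (by norm_num))
  have hd1 : ∀ t : ℝ, HasDerivAt (fun t : ℝ => h (x + t • v)) ⟪gradient h (x + t • v), v⟫ t := by
    intro t
    have h1 := ((hh.differentiable (by norm_num)) (x + t • v)).hasGradientAt.hasFDerivAt
    exact h1.comp_hasDerivAt t (hline t)
  have hd2 : ∀ t : ℝ, HasDerivAt (fun t : ℝ => ⟪gradient h (x + t • v), v⟫)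
      ⟪Hess h (x + t • v) v, v⟫ t := by
    intro t
    have h1 := (hgrad (x + t • v)).hasFDerivAt.comp_hasDerivAt t (hline t)
    simpa [Hess] using h1.inner ℝ (hasDerivAt_const t v)
  obtain ⟨c, hc, hceq⟩ := exists_hasDerivAt_eq_slope _ _ zero_lt_one
    (fun t _ => (hd1 t).continuousAt.continuousWithinAt) (fun t _ => hd1 t)
  obtain ⟨b, hb, hbeq⟩ := exists_hasDerivAt_eq_slope _ _ hc.1
    (fun t _ => (hd2 t).continuousAt.continuousWithinAt) (fun t _ => hd2 t)
  rw [eq_div_iff (by linarith [hc.1])] at hbeq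
  simp only [one_smul, zero_smul, add_zero, sub_zero, div_one] at hceq hbeq
  rw [← hceq, ← hbeq, abs_mul, abs_of_pos hc.1]
  have h1 := hK b ⟨hb.1.le, (hb.2.trans hc.2).le⟩
  nlinarith [abs_nonneg ⟪Hess h (x + b • v) v, v⟫, hc.1, hc.2]

lemma abs_log_sub_log_sub_le {a b : ℝ} (ha : 0 < a) (hb : a / 2 ≤ b) :
    |Real.log b - Real.log a - (b - a) / a| ≤ 2 * ((b - a) / a) ^ 2 := by
  have hb0 : 0 < b := by linarith
  rw [← Real.log_div hb0.ne' ha.ne']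
  have hr : (b - a) / a = b / a - 1 := by field_simp
  have hr2 : 1 / 2 ≤ b / a := by rw [le_div_iff₀ ha]; linarith
  rw [hr]
  generalize b / a = r at hr2
  have hr0 : 0 < r := by linarith
  have h1 := Real.log_le_sub_one_of_pos hr0
  have h2 := Real.one_sub_inv_le_log_of_pos hr0
  have h3 : 1 - r⁻¹ - (r - 1) = - (r⁻¹ * (r - 1) ^ 2) := by field_simp; ring
  have h4 : r⁻¹ ≤ 2 := by rw [inv_le_comm₀ hr0 two_pos]; linarith
  rw [abs_le]
  constructor <;> nlinarith [sq_nonneg (r - 1)]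

/-- If `φ` admits first-order expansions with quadratic remainder at two points, then the
linear parts differ by a multiple of the distance between the points. -/
lemma norm_sub_le_of_quadratic_remainder {E : Type*} [NormedAddCommGroup E]
    [InnerProductSpace ℝ E] {φ : E → ℝ} {x y p r : E} {K δ : ℝ}
    (hx : ∀ v, ‖v‖ ≤ δ → |φ (x + v) - φ x - ⟪p, v⟫| ≤ K * ‖v‖ ^ 2)
    (hy : ∀ v, ‖v‖ ≤ δ → |φ (y + v) - φ y - ⟪r, v⟫| ≤ K * ‖v‖ ^ 2)
    (hK : 0 ≤ K) (hne : x ≠ y) (hxy : 2 * ‖y - x‖ ≤ δ) :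
    ‖r - p‖ ≤ 6 * K * ‖y - x‖ := by
  have hs : 0 < ‖y - x‖ := norm_pos_iff.2 (sub_ne_zero.2 hne.symm)
  by_cases he : r - p = 0
  · rw [he, norm_zero]; positivity
  have he' : 0 < ‖r - p‖ := norm_pos_iff.2 he
  set w : E := (‖y - x‖ / ‖r - p‖) • (r - p) with hw
  have hwn : ‖w‖ = ‖y - x‖ := by
    rw [hw, norm_smul, Real.norm_of_nonneg (by positivity)]; field_simp
  have hin : ⟪r - p, w⟫ = ‖y - x‖ * ‖r - p‖ := by
    rw [hw, real_inner_smul_right, real_inner_self_eq_norm_sq]; field_simp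
  have hsw : ‖(y - x) + w‖ ≤ 2 * ‖y - x‖ := (norm_add_le _ _).trans (by rw [hwn]; linarith)
  have h1 := hx ((y - x) + w) (hsw.trans hxy)
  have h2 := hx (y - x) (by linarith)
  have h3 := hy w (by rw [hwn]; linarith)
  have h4 : K * ‖(y - x) + w‖ ^ 2 ≤ K * (2 * ‖y - x‖) ^ 2 := by gcongr
  rw [show x + ((y - x) + w) = y + w by abel, inner_add_right] at h1
  rw [show x + (y - x) = y by abel] at h2
  rw [hwn] at h3
  rw [inner_sub_left] at hin
  rw [abs_le] at h1 h2 h3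
  have h5 : ‖y - x‖ * ‖r - p‖ ≤ ‖y - x‖ * (6 * K * ‖y - x‖) := by linarith
  exact le_of_mul_le_mul_left h5 hs

lemma norm_Hxz_le {m : ℕ} {f : E → ℝ} {g : Fin m → E → ℝ} {x : E} {z : Fin m → ℝ}
    {ε Cg CG Cf Cz : ℝ} (hε : 0 < ε) (hg : ∀ i, ε ≤ g i x) (hz : ∀ i, 0 < z i)
    (hCg : ∀ i, ‖gradient (g i) x‖ ≤ Cg) (hCG : ∀ i, ‖Hess (g i) x‖ ≤ CG)
    (hCf : ‖Hess f x‖ ≤ Cf) (hCz : ∀ i, z i ≤ Cz) :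
    ‖Hxz f g x z‖ ≤ Cf + m * (Cz * CG) + m * (Cz / ε * (Cg * Cg)) := by
  have h1 : ‖∑ i, z i • Hess (g i) x‖ ≤ m * (Cz * CG) := by
    refine (norm_sum_le_of_le (f := fun i => z i • Hess (g i) x) _
      (n := fun _ => Cz * CG) fun i _ => ?_).trans (by simp)
    rw [norm_smul, Real.norm_of_nonneg (hz i).le]
    exact mul_le_mul (hCz i) (hCG i) (norm_nonneg _) ((hz i).le.trans (hCz i))
  have h2 : ‖∑ i, (z i / g i x) •
      ((innerSL ℝ (gradient (g i) x)).smulRight (gradient (g i) x))‖ ≤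
      m * (Cz / ε * (Cg * Cg)) := by
    refine (norm_sum_le_of_le _ (n := fun _ => Cz / ε * (Cg * Cg)) fun i _ => ?_).trans (by simp)
    have hgi : 0 < g i x := hε.trans_le (hg i)
    have hCz0 : 0 ≤ Cz := (hz i).le.trans (hCz i)
    have hCg0 : 0 ≤ Cg := (norm_nonneg _).trans (hCg i)
    rw [norm_smul, Real.norm_of_nonneg (div_nonneg (hz i).le hgi.le),
      ContinuousLinearMap.norm_smulRight_apply, innerSL_apply_norm]
    exact mul_le_mul (div_le_div₀ hCz0 (hCz i) hε (hg i))
      (mul_le_mul (hCg i) (hCg i) (norm_nonneg _) hCg0) (by positivity) (by positivity)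
  refine (norm_add_le _ _).trans (add_le_add ((norm_sub_le _ _).trans (add_le_add hCf h1)) h2)

/-- Quadratic remainder estimate for the log-barrier function. -/
lemma abs_barrierPhi_sub_sub_le {m : ℕ} {μ : ℝ} {f : E → ℝ} {g : Fin m → E → ℝ} {x v : E}
    {ε Cg K : ℝ} (hμ : 0 < μ) (hε : 0 < ε) (hv : ‖v‖ ≤ 1) (hK : 0 ≤ K)
    (hg : ∀ i, ε ≤ g i x) (hgv : ∀ i, |g i (x + v) - g i x| ≤ ε / 2)
    (hCg : ∀ i, ‖gradient (g i) x‖ ≤ Cg)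
    (hf : |f (x + v) - f x - ⟪gradient f x, v⟫| ≤ K * ‖v‖ ^ 2)
    (hgr : ∀ i, |g i (x + v) - g i x - ⟪gradient (g i) x, v⟫| ≤ K * ‖v‖ ^ 2) :
    |barrierPhi μ f g (x + v) - barrierPhi μ f g x - ⟪qmu μ f g x, v⟫| ≤
      (K + μ * (m * (K / ε + 2 * ((Cg + K) / ε) ^ 2))) * ‖v‖ ^ 2 := by
  have hlog : ∀ i, |Real.log (g i (x + v)) - Real.log (g i x) -
      (g i x)⁻¹ * ⟪gradient (g i) x, v⟫| ≤ (K / ε + 2 * ((Cg + K) / ε) ^ 2) * ‖v‖ ^ 2 := by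
    intro i
    have ha : 0 < g i x := hε.trans_le (hg i)
    have hb : g i x / 2 ≤ g i (x + v) := by linarith [(abs_le.1 (hgv i)).1, hg i]
    have h1 := abs_log_sub_log_sub_le ha hb
    have hCg0 : 0 ≤ Cg := (norm_nonneg _).trans (hCg i)
    have h2 : |g i (x + v) - g i x| ≤ (Cg + K) * ‖v‖ := by
      have h3 : |⟪gradient (g i) x, v⟫| ≤ Cg * ‖v‖ :=
        (abs_real_inner_le_norm _ _).trans (by gcongr; exact hCg i)
      have h4 : K * ‖v‖ ^ 2 ≤ K * ‖v‖ := by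
        gcongr; nlinarith [norm_nonneg v]
      have h5 := abs_add_le (g i (x + v) - g i x - ⟪gradient (g i) x, v⟫) ⟪gradient (g i) x, v⟫
      rw [sub_add_cancel] at h5
      linarith [hgr i]
    have h3 : |(g i (x + v) - g i x) / g i x| ≤ (Cg + K) / ε * ‖v‖ := by
      rw [abs_div, abs_of_pos ha, div_mul_eq_mul_div]
      exact div_le_div₀ (by positivity) h2 hε (hg i)
    have h4 : ((g i (x + v) - g i x) / g i x) ^ 2 ≤ ((Cg + K) / ε * ‖v‖) ^ 2 := by
      rw [← sq_abs]; gcongr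
    have h5 : |(g i (x + v) - g i x) / g i x - (g i x)⁻¹ * ⟪gradient (g i) x, v⟫| ≤
        K * ‖v‖ ^ 2 / ε := by
      rw [show (g i (x + v) - g i x) / g i x - (g i x)⁻¹ * ⟪gradient (g i) x, v⟫ =
        (g i (x + v) - g i x - ⟪gradient (g i) x, v⟫) / g i x by field_simp, abs_div,
        abs_of_pos ha]
      exact div_le_div₀ (by positivity) (hgr i) hε (hg i)
    refine (abs_sub_le _ ((g i (x + v) - g i x) / g i x) _).trans ?_
    calc _ ≤ 2 * ((Cg + K) / ε * ‖v‖) ^ 2 + K * ‖v‖ ^ 2 / ε := by linarith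
      _ = _ := by ring
  have hdecomp : barrierPhi μ f g (x + v) - barrierPhi μ f g x - ⟪qmu μ f g x, v⟫ =
      (f (x + v) - f x - ⟪gradient f x, v⟫) -
        μ * ∑ i, (Real.log (g i (x + v)) - Real.log (g i x) -
          (g i x)⁻¹ * ⟪gradient (g i) x, v⟫) := by
    simp only [barrierPhi, qmu, inner_sub_left, real_inner_smul_left, sum_inner,
      Finset.sum_sub_distrib]
    ring
  have hsum : |∑ i, (Real.log (g i (x + v)) - Real.log (g i x) -
      (g i x)⁻¹ * ⟪gradient (g i) x, v⟫)| ≤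
      m * ((K / ε + 2 * ((Cg + K) / ε) ^ 2) * ‖v‖ ^ 2) :=
    (Finset.abs_sum_le_sum_abs _ _).trans
      ((Finset.sum_le_sum fun i _ => hlog i).trans (by simp))
  rw [hdecomp]
  refine (abs_sub _ _).trans ?_
  rw [abs_mul, abs_of_pos hμ]
  calc _ ≤ K * ‖v‖ ^ 2 + μ * (m * ((K / ε + 2 * ((Cg + K) / ε) ^ 2) * ‖v‖ ^ 2)) := by gcongr
    _ = _ := by ring

/-- A sublevel bound on the barrier function keeps the constraints away from zero. -/
lemma exp_le_of_barrierPhi_le {E : Type*} {m : ℕ} {μ : ℝ} {f : E → ℝ} {g : Fin m → E → ℝ} {x : E}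
    {Lb M Φ₀ : ℝ} (hμ : 0 < μ) (hpos : ∀ i, 0 < g i x) (hM : ∀ i, Real.log (g i x) ≤ M)
    (hf : Lb ≤ f x) (hΦ : barrierPhi μ f g x ≤ Φ₀) (i : Fin m) :
    Real.exp (M - m * M + (Lb - Φ₀) / μ) ≤ g i x := by
  rw [← Real.le_log_iff_exp_le (hpos i)]
  have h1 : M - Real.log (g i x) ≤ ∑ j, (M - Real.log (g j x)) :=
    Finset.single_le_sum (f := fun j => M - Real.log (g j x))
      (fun j _ => sub_nonneg.2 (hM j)) (Finset.mem_univ i)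
  rw [Finset.sum_sub_distrib] at h1
  simp only [Finset.sum_const, Finset.card_univ, Fintype.card_fin, nsmul_eq_mul] at h1
  have h2 : (Lb - Φ₀) / μ ≤ ∑ j, Real.log (g j x) := by
    rw [div_le_iff₀ hμ]
    unfold barrierPhi at hΦ
    linarith
  linarith

/-- Under the inner-iteration setting, if moreover
`lim_{ℓ→∞} max_i |z^ℓ_i − μ/g_i(x^ℓ)| = 0` (stated componentwise), then
`lim_{ℓ→∞} ‖∇_x L(x^ℓ, z^ℓ)‖ = 0`. -/
theorem inner_lim_gradL_eq_zero
    {E : Type*} [NormedAddCommGroup E] [InnerProductSpace ℝ E] [FiniteDimensional ℝ E]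
    [Nontrivial E] {m : ℕ}
    (f : E → ℝ) (g : Fin m → E → ℝ) (μ τ κC ω Δmax : ℝ)
    (x : ℕ → E) (z : ℕ → Fin m → ℝ) (d : ℕ → E) (Δ : ℕ → ℝ)
    (hset : InnerSetting m f g μ τ κC ω Δmax x z d Δ)
    (hz : ∀ i, Tendsto (fun ℓ => |z ℓ i - μ / g i (x ℓ)|) atTop (𝓝 0)) :
    Tendsto (fun ℓ => ‖gradL f g (x ℓ) (z ℓ)‖) atTop (𝓝 0) := by
  classical
  have hμ := hset.hμ
  have hκ := hset.hκC
  have hτ := hset.hτ.1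
  obtain ⟨Lb, hLb⟩ := hset.bound_fbelow
  obtain ⟨U, hU, hgU⟩ := hset.bound_g
  obtain ⟨Cg, hCg, hgradg⟩ := hset.bound_gradg
  obtain ⟨CG, hCG, hhessg⟩ := hset.bound_hessg
  obtain ⟨Cf, hCf, hhessf⟩ := hset.bound_hessf
  obtain ⟨Cz, hCz, hzC⟩ := hset.bound_z
  obtain ⟨β, hβ, δ₂, hδ₂, hrad⟩ := hset.radial_hess
  have hpred : ∀ C, 0 < C → ∀ l, ‖Hxz f g (x l) (z l)‖ ≤ C →
      κC * ‖qmu μ f g (x l)‖ * min (Δ l) (‖qmu μ f g (x l)‖ / C) ≤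
        predRed μ f g (x l) (z l) (d l) := by
    intro C hC l hle
    by_cases hH : Hxz f g (x l) (z l) = 0
    · refine le_trans ?_ (hset.cauchy_zero l hH)
      gcongr
      exact min_le_left _ _
    · refine le_trans ?_ (hset.cauchy l hH)
      have := norm_pos_iff.2 hH
      gcongr
  have hpred0 : ∀ l, 0 ≤ predRed μ f g (x l) (z l) (d l) := by
    intro l
    have hC : 0 < ‖Hxz f g (x l) (z l)‖ + 1 := by positivity
    refine le_trans (mul_nonneg (by positivity) (le_min (hset.hΔ l).1.le (by positivity)))
      (hpred _ hC l (by linarith))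
  have hΦanti : Antitone fun l => barrierPhi μ f g (x l) := by
    refine antitone_nat_of_succ_le fun l => ?_
    by_cases hS : (∀ i, 0 < g i (x l + d l)) ∧
      τ * predRed μ f g (x l) (z l) (d l) < aredRed μ f g (x l) (d l)
    · have h1 := hS.2
      have h2 := mul_nonneg hτ.le (hpred0 l)
      rw [hset.succ_update l hS]
      unfold aredRed at h1
      linarith
    · rw [(hset.fail_update l hS).1]
  have hlogM : ∀ l i, Real.log (g i (x l)) ≤ Real.log U := fun l i =>
    Real.log_le_log (hset.hgpos l i) (hgU l i)
  obtain ⟨ε, hε, hgε⟩ : ∃ ε > 0, ∀ l i, ε ≤ g i (x l) :=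
    ⟨_, Real.exp_pos _, fun l i => exp_le_of_barrierPhi_le hμ (hset.hgpos l) (hlogM l) (hLb l)
      (hΦanti (Nat.zero_le l)) i⟩
  have hΦlow : ∀ l, Lb - μ * (m * Real.log U) ≤ barrierPhi μ f g (x l) := by
    intro l
    have h1 : ∑ i, Real.log (g i (x l)) ≤ m * Real.log U :=
      (Finset.sum_le_sum fun i _ => hlogM l i).trans (by simp)
    unfold barrierPhi
    exact sub_le_sub (hLb l) (mul_le_mul_of_nonneg_left h1 hμ.le)
  obtain ⟨CH, hCH, hH⟩ : ∃ CH > 0, ∀ l, ‖Hxz f g (x l) (z l)‖ ≤ CH :=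
    ⟨_, by positivity, fun l => norm_Hxz_le hε (hgε l) (hset.hzpos l) (hgradg l) (hhessg l)
      (hhessf l) (hzC l)⟩
  obtain ⟨δ₀, hδ₀, hcont⟩ := hset.unif_cont (ε / 2) (by positivity)
  have hquad : ∃ K > 0, ∃ δ > 0, ∀ l v, ‖v‖ ≤ δ →
      |barrierPhi μ f g (x l + v) - barrierPhi μ f g (x l) - ⟪qmu μ f g (x l), v⟫| ≤
        K * ‖v‖ ^ 2 := by
    have hK : 0 < Cf + CG + β * δ₂ := by positivity
    refine ⟨(Cf + CG + β * δ₂) + μ * (m * ((Cf + CG + β * δ₂) / ε +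
      2 * ((Cg + (Cf + CG + β * δ₂)) / ε) ^ 2)), by positivity, min 1 (min δ₀ δ₂),
      by positivity, fun l v hv => ?_⟩
    rw [le_min_iff, le_min_iff] at hv
    have hquadform : ∀ (h : E → ℝ) (C : ℝ), ContDiff ℝ 2 h → C ≤ Cf + CG → ‖Hess h (x l)‖ ≤ C →
        (∀ t ∈ Set.Icc (0 : ℝ) 1,
          |⟪(Hess h (x l + t • v) - Hess h (x l)) v, v⟫| ≤ β * t * ‖v‖ ^ 3) →
        |h (x l + v) - h (x l) - ⟪gradient h (x l), v⟫| ≤ (Cf + CG + β * δ₂) * ‖v‖ ^ 2 := by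
      intro h C hh hC hhC hdiff
      refine abs_sub_sub_inner_gradient_le hh fun t ht => ?_
      have h1 := hdiff t ht
      have h2 : |⟪Hess h (x l) v, v⟫| ≤ (Cf + CG) * ‖v‖ ^ 2 := by
        refine (abs_real_inner_le_norm _ _).trans ?_
        have := (Hess h (x l)).le_of_opNorm_le (hhC.trans hC) v
        nlinarith [norm_nonneg v]
      have h3 : β * t * ‖v‖ ^ 3 ≤ β * δ₂ * ‖v‖ ^ 2 := by
        have : t * ‖v‖ ≤ δ₂ := by nlinarith [norm_nonneg v, ht.1, ht.2]
        calc β * t * ‖v‖ ^ 3 = β * (t * ‖v‖) * ‖v‖ ^ 2 := by ring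
          _ ≤ _ := by gcongr
      have h4 := abs_add_le ⟪(Hess h (x l + t • v) - Hess h (x l)) v, v⟫ ⟪Hess h (x l) v, v⟫
      rw [← inner_add_left, sub_apply, sub_add_cancel] at h4
      rw [sub_apply] at h1
      linarith
    have htv : ∀ t ∈ Set.Icc (0 : ℝ) 1, t * ‖v‖ ≤ δ₂ := fun t ht =>
      (mul_le_of_le_one_left (norm_nonneg v) ht.2).trans hv.2.2
    exact abs_barrierPhi_sub_sub_le hμ hε hv.1 hK.le (hgε l) (fun i => hcont l i v hv.2.1)
      (hgradg l) (hquadform f Cf hset.hf (by linarith) (hhessf l)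
        fun t ht => (hrad l t v ht.1 (htv t ht)).1)
      fun i => hquadform (g i) CG (hset.hg i) (by linarith) (hhessg l i)
        fun t ht => (hrad l t v ht.1 (htv t ht)).2 i
  obtain ⟨K, hK, δ, hδ, hquad⟩ := hquad
  have hq0 : Tendsto (fun l => ‖qmu μ f g (x l)‖) atTop (𝓝 0) := by
    refine tendsto_norm_zero_of_trustRegion (x := x) (Δ := Δ)
      (Φ := fun l => barrierPhi μ f g (x l))
      (S := fun l => (∀ i, 0 < g i (x l + d l)) ∧
        τ * predRed μ f g (x l) (z l) (d l) < aredRed μ f g (x l) (d l))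
      (κ := τ * κC) (ρ := max ω (1 / 4)) (mul_pos hτ hκ) hCH (by positivity)
      (max_lt hset.hω.2 (by norm_num)) (fun l => (hset.hΔ l).1) hΦlow ?_ ?_ ?_ ?_ ?_ ?_
    · intro l hS
      have h1 := mul_le_mul_of_nonneg_left (hpred CH hCH l (hH l)) hτ.le
      have h2 := hS.2
      simp only [hset.succ_update l hS]
      unfold aredRed at h2
      linarith
    · intro l hS
      rw [hset.succ_update l hS, add_sub_cancel_left]
      exact hset.hdΔ l
    · intro l hS
      have h := (hset.fail_update l hS).1
      simp only [h, and_self]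
    · intro e he
      obtain ⟨r, hr, hrδ, hrC, hrK⟩ : ∃ r > 0, r ≤ δ ∧ r ≤ e / CH ∧
          r ≤ κC * e / (2 * (K + CH)) :=
        ⟨min δ (min (e / CH) (κC * e / (2 * (K + CH)))), by positivity, min_le_left _ _,
          (min_le_right _ _).trans (min_le_left _ _), (min_le_right _ _).trans (min_le_right _ _)⟩
      have hω := hset.hω.1
      refine ⟨min (ω * δ₀) (r / 4), by positivity, fun l hle => ?_⟩
      by_cases hfeas : ∀ i, 0 < g i (x l + d l)
      · by_cases hsh : aredRed μ f g (x l) (d l) < predRed μ f g (x l) (z l) (d l) / 4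
        · rw [hset.Δ_shrink l hfeas hsh]
          suffices r < Δ l from (min_le_right _ _).trans ((min_le_right _ _).trans (by linarith))
          by_contra! hΔr
          have hΔ0 := (hset.hΔ l).1
          have hdl := hset.hdΔ l
          have h1 := hpred CH hCH l (hH l)
          have h2 : κC * e * Δ l ≤
              κC * ‖qmu μ f g (x l)‖ * min (Δ l) (‖qmu μ f g (x l)‖ / CH) := by
            have : Δ l ≤ ‖qmu μ f g (x l)‖ / CH := hΔr.trans (hrC.trans (by gcongr))
            rw [min_eq_left this]
            gcongr
          have h3 := hquad l (d l) (hdl.trans (hΔr.trans hrδ))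
          have h4 : |⟪Hxz f g (x l) (z l) (d l), d l⟫| ≤ CH * ‖d l‖ ^ 2 := by
            refine (abs_real_inner_le_norm _ _).trans ?_
            have := (Hxz f g (x l) (z l)).le_of_opNorm_le (hH l) (d l)
            nlinarith [norm_nonneg (d l)]
          have h5 : predRed μ f g (x l) (z l) (d l) - (K + CH) * ‖d l‖ ^ 2 ≤
              aredRed μ f g (x l) (d l) := by
            unfold aredRed predRed trModel
            have := (abs_le.1 h3).2
            have := (abs_le.1 h4).1
            nlinarith [sq_nonneg ‖d l‖]
          have h6 : (K + CH) * ‖d l‖ ^ 2 ≤ (K + CH) * (r * Δ l) := by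
            have : ‖d l‖ ^ 2 ≤ r * Δ l := by
              rw [sq]
              exact mul_le_mul (hdl.trans hΔr) hdl (norm_nonneg _) hr.le
            gcongr
          have h7 : (K + CH) * (r * Δ l) ≤ κC * e * Δ l / 2 := by
            rw [le_div_iff₀ (by positivity)] at hrK
            nlinarith
          have h8 : 0 < κC * e * Δ l := by positivity
          linarith
        · refine (min_le_left _ _).trans ?_
          by_cases hex : (3/4) * predRed μ f g (x l) (z l) (d l) ≤ aredRed μ f g (x l) (d l) ∧
              ‖d l‖ = Δ l
          · rw [hset.Δ_expand l hfeas hex.1 hex.2]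
            exact le_min (by linarith [(hset.hΔ l).1]) (hset.hΔ l).2
          · rw [hset.Δ_keep l hfeas hsh hex]
      · push Not at hfeas
        rw [hset.Δ_infeas l hfeas]
        obtain ⟨i, hi⟩ := hfeas
        refine (min_le_right _ _).trans ((min_le_left _ _).trans ?_)
        have : δ₀ ≤ ‖d l‖ := by
          by_contra! hlt
          have h1 := (abs_le.1 (hcont l i (d l) hlt.le)).1
          linarith [hgε l i]
        gcongr
    · intro l hS hq
      have hΔ0 := (hset.hΔ l).1
      by_cases hfeas : ∀ i, 0 < g i (x l + d l)
      · have hp : 0 < predRed μ f g (x l) (z l) (d l) := by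
          have hqn := norm_pos_iff.2 hq
          exact (mul_pos (by positivity) (lt_min hΔ0 (by positivity))).trans_le
            (hpred CH hCH l (hH l))
        have h1 : aredRed μ f g (x l) (d l) ≤ τ * predRed μ f g (x l) (z l) (d l) :=
          not_lt.1 fun h => hS ⟨hfeas, h⟩
        have h2 : aredRed μ f g (x l) (d l) < predRed μ f g (x l) (z l) (d l) / 4 := by
          nlinarith [hset.hτ.2]
        rw [hset.Δ_shrink l hfeas h2]
        calc Δ l / 4 = 1 / 4 * Δ l := by ring
          _ ≤ _ := by gcongr; exact le_max_right _ _
      · push Not at hfeas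
        rw [hset.Δ_infeas l hfeas]
        exact mul_le_mul (le_max_left _ _) (hset.hdΔ l) (norm_nonneg _) (by positivity)
    · intro e he
      refine ⟨min (δ / 2) (e / (12 * K)), by positivity, fun k l hkl => ?_⟩
      rw [le_min_iff, le_div_iff₀ two_pos, le_div_iff₀ (by positivity)] at hkl
      by_cases hne : x l = x k
      · rw [hne, sub_self, norm_zero]
        exact he
      · have h1 := norm_sub_le_of_quadratic_remainder (hquad l) (hquad k) hK.le hne
          (by linarith [hkl.1])
        linarith [hkl.2]
  have hdiff : ∀ l, ‖gradL f g (x l) (z l)‖ ≤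
      ‖qmu μ f g (x l)‖ + ∑ i, |z l i - μ / g i (x l)| * Cg := by
    intro l
    have h1 : gradL f g (x l) (z l) =
        qmu μ f g (x l) - ∑ i, (z l i - μ / g i (x l)) • gradient (g i) (x l) := by
      simp only [gradL, qmu, sub_smul, Finset.sum_sub_distrib, Finset.smul_sum, smul_smul,
        div_eq_mul_inv]
      abel
    rw [h1]
    refine (norm_sub_le _ _).trans (add_le_add le_rfl (norm_sum_le_of_le _ fun i _ => ?_))
    rw [norm_smul, Real.norm_eq_abs]
    gcongr
    exact hgradg l i
  refine squeeze_zero (fun l => norm_nonneg _) hdiff ?_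
  simpa using hq0.add (tendsto_finsetSum Finset.univ fun i _ => (hz i).mul_const Cg)

end
end
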